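/- arXiv:1503.07074 — 10 statements merged into one kernel-verified Lean document; each statement's English description precedes it below -/
import Mathlib

section
/- Let P(X) = a_0 + a_1 X + ... + a_k X^k be a polynomial with complex constant coefficients and a_k ≠ 0. If the differential equation w·w'' − (w')² + P(w) = 0 admits a nonconstant meromorphic solution on ℂ, then k ≤ 4. -/
open Filter Topology

lemma sum_mul_pow_eq_pow_mul_sum_inv (k : ℕ) (a : ℕ → ℂ) {x : ℂ} (hx : x ≠ 0) :
    ∑ n ∈ Finset.range (k + 1), a n * x ^ n
      = x ^ k * ∑ n ∈ Finset.range (k + 1), a n * x⁻¹ ^ (k - n) := by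
  rw [Finset.mul_sum]
  refine Finset.sum_congr rfl fun n hn => ?_
  have hnk : n ≤ k := by grind
  rw [← Nat.sub_add_cancel hnk, pow_add, Nat.add_sub_cancel, inv_pow]
  field_simp

lemma tendsto_sum_mul_pow_sub (k : ℕ) (a : ℕ → ℂ) {α : Type*} {l : Filter α} {v : α → ℂ}
    (hv : Tendsto v l (𝓝 0)) :
    Tendsto (fun z => ∑ n ∈ Finset.range (k + 1), a n * v z ^ (k - n)) l (𝓝 (a k)) := by
  have hcont : Continuous fun y : ℂ => ∑ n ∈ Finset.range (k + 1), a n * y ^ (k - n) := by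
    fun_prop
  have h0 : ∑ n ∈ Finset.range (k + 1), a n * (0 : ℂ) ^ (k - n) = a k := by
    rw [Finset.sum_range_succ, Finset.sum_eq_zero]
    · simp
    · intro n hn
      have : k - n ≠ 0 := by grind
      simp [this]
  simpa [h0, Function.comp_def] using (hcont.tendsto 0).comp hv

lemma deriv_deriv_inv {v : ℂ → ℂ} {z : ℂ} (hv : AnalyticAt ℂ v z) (hz : v z ≠ 0) :
    deriv (deriv v⁻¹) z = -deriv (deriv v) z / v z ^ 2 + 2 * deriv v z ^ 2 / v z ^ 3 := by
  have h : deriv v⁻¹ =ᶠ[𝓝 z] fun y => -deriv v y / v y ^ 2 := by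
    filter_upwards [hv.eventually_analyticAt, hv.continuousAt.eventually_ne hz] with y hy hy0
    exact deriv_inv'' hy.differentiableAt hy0
  have h' := hv.deriv.differentiableAt.hasDerivAt.neg.div
    (hv.differentiableAt.hasDerivAt.pow 2) (pow_ne_zero 2 hz)
  rw [h.deriv_eq]
  refine h'.deriv.trans ?_
  simp
  field_simp

/-- A solution of `w w'' - w' ^ 2 + P(w) = 0` with `deg P ≥ 5` has no poles. -/
lemma meromorphicOrderAt_nonneg_of_solution {k : ℕ} (hk : 5 ≤ k) {a : ℕ → ℂ} (hak : a k ≠ 0)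
    {w : ℂ → ℂ} {x : ℂ} (hw : MeromorphicAt w x)
    (heq : ∀ z : ℂ, AnalyticAt ℂ w z →
      w z * deriv (deriv w) z - (deriv w z) ^ 2
        + ∑ n ∈ Finset.range (k + 1), a n * (w z) ^ n = 0) :
    0 ≤ meromorphicOrderAt w x := by
  by_contra! hneg
  have hinv : Tendsto w⁻¹ (𝓝[≠] x) (𝓝 0) :=
    tendsto_inv₀_cobounded.comp (tendsto_cobounded_iff_meromorphicOrderAt_neg hw |>.2 hneg)
  have hpos := (tendsto_zero_iff_meromorphicOrderAt_pos hw.inv).1 hinv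
  set v := toMeromorphicNFAt w⁻¹ x
  have hv : AnalyticAt ℂ v x :=
    hw.inv.meromorphicOrderAt_nonneg_iff_analyticAt_toMeromorphicNFAt.1 hpos.le
  have hvw : w⁻¹ =ᶠ[𝓝[≠] x] v := hw.inv.eq_nhdsNE_toMeromorphicNFAt
  have hvlim : Tendsto v (𝓝[≠] x) (𝓝 (v x)) := hv.continuousAt.tendsto.mono_left nhdsWithin_le_nhds
  have hvx : v x = 0 := tendsto_nhds_unique hvlim (hinv.congr' hvw)
  have hw0 : ∀ᶠ z in 𝓝[≠] x, w z ≠ 0 :=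
    (tendsto_cobounded_iff_meromorphicOrderAt_neg hw |>.2 hneg).eventually_ne_cobounded 0
  have hlim := tendsto_sum_mul_pow_sub k a (hvx ▸ hvlim)
  have hlim' : Tendsto (fun z => v z ^ (k - 4) * (v z * deriv (deriv v) z - deriv v z ^ 2))
      (𝓝[≠] x) (𝓝 0) := by
    have hc : ContinuousAt
        (fun z => v z ^ (k - 4) * (v z * deriv (deriv v) z - deriv v z ^ 2)) x :=
      (hv.continuousAt.pow _).mul
        ((hv.continuousAt.mul hv.deriv.deriv.continuousAt).sub (hv.deriv.continuousAt.pow 2))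
    have := hc.tendsto.mono_left (nhdsWithin_le_nhds (s := {x}ᶜ))
    rwa [hvx, zero_pow (by omega), zero_mul] at this
  refine hak (tendsto_nhds_unique (hlim.congr' ?_) hlim')
  filter_upwards [hw.eventually_analyticAt, hw0, hv.eventually_analyticAt.filter_mono
    nhdsWithin_le_nhds, eventually_eventually_nhdsWithin.2 hvw, hvw, self_mem_nhdsWithin]
    with z hwz hz0 hvz hloc hz hzx
  rw [(isOpen_compl_singleton.nhdsWithin_eq hzx)] at hloc
  have hwv : w =ᶠ[𝓝 z] v⁻¹ := by
    filter_upwards [hloc] with y hy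
    rw [Pi.inv_apply, ← hy, Pi.inv_apply, inv_inv]
  have hvz0 : v z ≠ 0 := by rw [← hz]; exact inv_ne_zero hz0
  have h := heq z hwz
  rw [sum_mul_pow_eq_pow_mul_sum_inv k a hz0, hwv.deriv.deriv_eq, hwv.deriv_eq,
    deriv_deriv_inv hvz hvz0, deriv_inv'' hvz.differentiableAt hvz0, hwv.eq_of_nhds,
    Pi.inv_apply, inv_inv] at h
  generalize ∑ n ∈ Finset.range (k + 1), a n * v z ^ (k - n) = S at h ⊢
  obtain ⟨m, rfl⟩ := Nat.exists_eq_add_of_le' (show 4 ≤ k by omega)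
  rw [Nat.add_sub_cancel]
  rw [inv_pow, pow_add] at h
  field_simp at h
  linear_combination h

/-- If `|f z|` is large for a solution `f` of `f f'' - f' ^ 2 + P(f) = 0` with `deg P ≥ 5`, then
`|f|` at least doubles within distance `1 / |f z|` of `z`. -/
lemma exists_norm_doubling_of_solution {k : ℕ} (hk : 5 ≤ k) {a : ℕ → ℂ} (hak : a k ≠ 0)
    {f : ℂ → ℂ} (hf : Differentiable ℂ f)
    (heq : ∀ z : ℂ, f z * deriv (deriv f) z - (deriv f z) ^ 2
        + ∑ n ∈ Finset.range (k + 1), a n * (f z) ^ n = 0) :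
    ∃ R : ℝ, 1 ≤ R ∧ ∀ z, R ≤ ‖f z‖ → ∃ z', dist z z' ≤ 1 / ‖f z‖ ∧ 2 * ‖f z‖ ≤ ‖f z'‖ := by
  have hc : 0 < ‖a k‖ / 2 := by positivity
  set c := ‖a k‖ / 2 with hcdef
  have hlim := (tendsto_sum_mul_pow_sub k a (tendsto_inv₀_cobounded (α := ℂ))).norm
  have hev := hlim.eventually (lt_mem_nhds (show c < ‖a k‖ by linarith))
  obtain ⟨r, -, hr⟩ := (hasBasis_cobounded_norm (E := ℂ)).eventually_iff.1 hev
  refine ⟨max (max r 1) (8 / c + 1), (le_max_right _ _).trans (le_max_left _ _), fun z hz => ?_⟩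
  obtain ⟨⟨hzr, hz1⟩, hzc⟩ : (r ≤ ‖f z‖ ∧ 1 ≤ ‖f z‖) ∧ 8 / c + 1 ≤ ‖f z‖ := by
    simpa only [max_le_iff] using hz
  have hS := hr (x := f z) hzr
  set A := ‖f z‖ with hA
  have hA0 : 0 < A := by linarith
  by_contra! hcon
  have hbound : ∀ y ∈ Metric.sphere z (1 / A), ‖f y‖ ≤ 2 * A := fun y hy =>
    (hcon y (by rw [dist_comm]; exact (Metric.mem_sphere.1 hy).le)).le
  have h1 : ‖deriv f z‖ ≤ 2 * A ^ 2 := by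
    refine (Complex.norm_deriv_le_of_forall_mem_sphere_norm_le (by positivity)
      hf.diffContOnCl hbound).trans_eq ?_
    field_simp
  have h2 : ‖deriv (deriv f) z‖ ≤ 4 * A ^ 3 := by
    have := Complex.norm_iteratedDeriv_le_of_forall_mem_sphere_norm_le 2 (by positivity)
      hf.diffContOnCl hbound
    rw [iteratedDeriv_succ, iteratedDeriv_one] at this
    refine this.trans_eq ?_
    simp only [Nat.factorial]
    push_cast
    field_simp
    ring
  have hfz : f z ≠ 0 := norm_pos_iff.1 hA0
  have h := heq z
  rw [sum_mul_pow_eq_pow_mul_sum_inv k a hfz] at h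
  set S := ∑ n ∈ Finset.range (k + 1), a n * (f z)⁻¹ ^ (k - n)
  have hP : f z ^ k * S = deriv f z ^ 2 - f z * deriv (deriv f) z := by linear_combination h
  have hle : A ^ k * ‖S‖ ≤ 8 * A ^ 4 := by
    calc A ^ k * ‖S‖ = ‖f z ^ k * S‖ := by rw [norm_mul, norm_pow]
      _ ≤ ‖deriv f z‖ ^ 2 + A * ‖deriv (deriv f) z‖ := by
        rw [hP, ← norm_pow, hA, ← norm_mul]; exact norm_sub_le _ _
      _ ≤ (2 * A ^ 2) ^ 2 + A * (4 * A ^ 3) := by gcongr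
      _ = 8 * A ^ 4 := by ring
  have h5 : A ^ 5 * c ≤ A ^ k * ‖S‖ :=
    mul_le_mul (pow_le_pow_right₀ hz1 hk) hS.le hc.le (by positivity)
  have h6 : A ^ 4 * (A * c) ≤ A ^ 4 * 8 := by linarith [show A ^ 5 * c = A ^ 4 * (A * c) by ring]
  have h7 : A * c ≤ 8 := le_of_mul_le_mul_left h6 (by positivity)
  have h8 : 8 / c < A := by linarith
  rw [div_lt_iff₀ hc] at h8
  linarith

lemma norm_lt_of_doubling {f : ℂ → ℂ} (hf : Continuous f) {R : ℝ} (hR : 1 ≤ R)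
    (h : ∀ z, R ≤ ‖f z‖ → ∃ z', dist z z' ≤ 1 / ‖f z‖ ∧ 2 * ‖f z‖ ≤ ‖f z'‖) (z : ℂ) :
    ‖f z‖ < R := by
  by_contra! hz
  choose! g hg1 hg2 using h
  set u : ℕ → ℂ := fun n => g^[n] z
  have hsucc : ∀ n, u (n + 1) = g (u n) := fun n => Function.iterate_succ_apply' g n z
  have hgrow : ∀ n, 2 ^ n * R ≤ ‖f (u n)‖ ∧ R ≤ ‖f (u n)‖ := by
    intro n
    induction n with
    | zero => simpa [u] using hz
    | succ n ih =>
      have := hg2 _ ih.2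
      rw [hsucc, pow_succ]
      constructor <;> linarith [ih.1, ih.2]
  have hpow : ∀ n, (2 : ℝ) ^ n ≤ ‖f (u n)‖ := fun n =>
    (le_mul_of_one_le_right (by positivity) hR).trans (hgrow n).1
  have hcauchy : CauchySeq u := by
    refine cauchySeq_of_le_geometric (1 / 2) 1 (by norm_num) fun n => ?_
    rw [hsucc]
    refine (hg1 _ (hgrow n).2).trans ?_
    rw [one_mul, one_div_pow]
    exact one_div_le_one_div_of_le (by positivity) (hpow n)
  obtain ⟨p, hp⟩ := cauchySeq_tendsto_of_complete hcauchy
  exact not_tendsto_atTop_of_tendsto_nhds ((hf.tendsto p).comp hp).norm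
    (tendsto_atTop_mono hpow (tendsto_pow_atTop_atTop_of_one_lt one_lt_two))

/-- Let `P(X) = a 0 + a 1 • X + ⋯ + a k • X^k` be a polynomial with complex
constant coefficients and `a k ≠ 0`.  If the differential equation
`w·w'' − (w')² + P(w) = 0` admits a nonconstant meromorphic solution on `ℂ`, then `k ≤ 4`. -/
theorem hayman_type1_degree_bound (k : ℕ) (a : ℕ → ℂ) (hak : a k ≠ 0) (w : ℂ → ℂ)
    (hmero : MeromorphicOn w Set.univ)
    (heq : ∀ z : ℂ, AnalyticAt ℂ w z →
      w z * deriv (deriv w) z - (deriv w z) ^ 2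
        + ∑ n ∈ Finset.range (k + 1), a n * (w z) ^ n = 0)
    (hnonconst : ¬ ∃ c : ℂ, ∀ z : ℂ, AnalyticAt ℂ w z → w z = c) :
    k ≤ 4 := by
  by_contra! hk
  set f := toMeromorphicNFOn w Set.univ
  have hfw : ∀ x, w =ᶠ[𝓝[≠] x] f := fun x =>
    (hmero.toMeromorphicNFOn_eq_self_on_nhdsNE (Set.mem_univ x)).symm
  have hf : ∀ x, AnalyticAt ℂ f x := fun x => by
    have hNF : MeromorphicNFAt f x := meromorphicNFOn_toMeromorphicNFOn w Set.univ (Set.mem_univ x)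
    rw [← hNF.meromorphicOrderAt_nonneg_iff_analyticAt, ← meromorphicOrderAt_congr (hfw x)]
    exact meromorphicOrderAt_nonneg_of_solution hk hak (hmero x (Set.mem_univ x)) heq
  have hwf : ∀ x, AnalyticAt ℂ w x → w =ᶠ[𝓝 x] f := fun x hx =>
    (hx.continuousAt.eventuallyEq_nhds_iff_eventuallyEq_nhdsNE (hf x).continuousAt).1 (hfw x)
  have hdiff : Differentiable ℂ f := fun x => (hf x).differentiableAt
  have hfeq : ∀ z : ℂ, f z * deriv (deriv f) z - (deriv f z) ^ 2
      + ∑ n ∈ Finset.range (k + 1), a n * (f z) ^ n = 0 := by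
    intro x
    have hcont : ContinuousAt (fun z => f z * deriv (deriv f) z - (deriv f z) ^ 2
        + ∑ n ∈ Finset.range (k + 1), a n * (f z) ^ n) x := by
      have h0 := (hf x).continuousAt
      have h1 := (hf x).deriv.continuousAt
      have h2 := (hf x).deriv.deriv.continuousAt
      fun_prop
    refine tendsto_nhds_unique (hcont.tendsto.mono_left (nhdsWithin_le_nhds (s := {x}ᶜ)))
      (tendsto_const_nhds.congr' ?_)
    filter_upwards [(hmero x (Set.mem_univ x)).eventually_analyticAt] with z hz
    have hloc := hwf z hz
    rw [← hloc.eq_of_nhds, ← hloc.deriv_eq, ← hloc.deriv.deriv_eq, heq z hz]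
  obtain ⟨R, hR, hdouble⟩ := exists_norm_doubling_of_solution hk hak hdiff hfeq
  have hbdd : Bornology.IsBounded (Set.range f) :=
    isBounded_iff_forall_norm_le.2 ⟨R, by
      rintro _ ⟨z, rfl⟩
      exact (norm_lt_of_doubling hdiff.continuous hR hdouble z).le⟩
  exact hnonconst ⟨f 0, fun z hz =>
    (hwf z hz).eq_of_nhds.trans (hdiff.apply_eq_apply_of_bounded hbdd z 0)⟩
end

section
/- Let P(X) = a_0 + a_1 X + a_2 X² + a_3 X³ + a_4 X⁴ with complex constant coefficients, where either a_4 ≠ 0 or (a_4 = 0 and a_3 ≠ 0) (i.e. deg P = 3 or 4). If the differential equation w·w'' − (w')² + P(w) = 0 admits a nonconstant meromorphic solution on ℂ, then a_2 = 0. -/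
open Filter Topology Set Metric

theorem false_of_integrable_ray_speed {u H : ℂ → ℂ} (hu : Differentiable ℂ u)
    (hH : Differentiable ℂ H) (hode : ∀ z, deriv (deriv u) z = H (u z)) {z₀ : ℂ} {g : ℝ → ℂ}
    (hg : ∀ t : ℝ, 0 ≤ t → HasDerivAt g (H (u z₀ + t) / g t) t) (hg₀ : ∀ t, 0 ≤ t → g t ≠ 0)
    (hinit : g 0 = deriv u z₀) {C : ℝ}
    (hbound : ∀ t, 0 ≤ t → ‖(g t)⁻¹‖ ≤ C * Real.exp (-t / 2)) : False := by
  have hu' : Differentiable ℂ (deriv u) := by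
    intro z
    exact ((hu.analyticAt z).deriv).differentiableAt
  set k : ℝ → ℂ := fun t => (g (max t 0))⁻¹ with hk
  have hkc : Continuous k := by
    rw [continuous_iff_continuousAt]
    intro t
    have h0 : (0 : ℝ) ≤ max t 0 := le_max_right _ _
    have h1 : ContinuousAt (fun t : ℝ => max t 0) t := by fun_prop
    exact (ContinuousAt.comp (f := fun t : ℝ => max t 0) (hg _ h0).continuousAt h1).inv₀ (hg₀ _ h0)
  have hkpos : ∀ t, 0 ≤ t → k t = (g t)⁻¹ := fun t ht => by simp [hk, ht]
  have hC : 0 ≤ C := by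
    have := (norm_nonneg _).trans (hbound 0 le_rfl)
    simpa using this
  set Φ : ℝ → ℂ := fun t => z₀ + ∫ s in (0 : ℝ)..t, k s with hΦ
  have hΦd : ∀ t, HasDerivAt Φ (k t) t := fun t =>
    ((hkc.integral_hasStrictDerivAt 0 t).hasDerivAt).const_add z₀
  have hΦ0 : Φ 0 = z₀ := by simp [hΦ]
  have hΦb : ∀ T, 0 ≤ T → ‖Φ T - z₀‖ ≤ 2 * C := by
    intro T hT
    have hB : ∀ x : ℝ, HasDerivAt (fun t : ℝ => 2 * C * (1 - Real.exp (-t / 2)))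
        (C * Real.exp (-x / 2)) x := by
      intro x
      have h1 : HasDerivAt (fun t : ℝ => -t / 2) (-1 / 2) x := (hasDerivAt_id x).neg.div_const 2
      have := ((h1.exp.const_sub 1).const_mul (2 * C))
      exact this.congr_deriv (by ring)
    have := image_norm_le_of_norm_deriv_right_le_deriv_boundary
      (f := fun t => Φ t - z₀) (f' := k) (a := 0) (b := T)
      (fun t _ => ((hΦd t).sub_const z₀).continuousAt.continuousWithinAt)
      (fun t _ => ((hΦd t).sub_const z₀).hasDerivWithinAt) (by simp [hΦ0]) hB
      (fun t ht => by rw [hkpos t ht.1]; exact hbound t ht.1) (right_mem_Icc.2 hT)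
    refine this.trans ?_
    nlinarith [Real.exp_pos (-T / 2)]
  have hkn : ∀ t, 0 ≤ t → ‖k t‖ ≤ C := by
    intro t ht
    rw [hkpos t ht]
    refine (hbound t ht).trans ?_
    have : Real.exp (-t / 2) ≤ 1 := Real.exp_le_one_iff.2 (by linarith)
    nlinarith
  have key : ∀ T : ℝ, 0 ≤ T → u (Φ T) = u z₀ + T := by
    intro T hT
    set V : ℂ × ℂ → ℂ × ℂ := fun p => (p.2, H p.1) with hV
    set f₁ : ℝ → ℂ × ℂ := fun t => (u (Φ t), deriv u (Φ t)) with hf₁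
    set f₂ : ℝ → ℂ × ℂ := fun t => (u z₀ + t, g t) with hf₂
    have hd₁ : ∀ t, HasDerivAt f₁ (k t • V (f₁ t)) t := by
      intro t
      have h1 := (hu (Φ t)).hasDerivAt.comp t (hΦd t)
      have h2 := (hu' (Φ t)).hasDerivAt.comp t (hΦd t)
      rw [hode] at h2
      exact (h1.prodMk h2).congr_deriv (by simp [hV, hf₁, mul_comm])
    have hd₂ : ∀ t, 0 ≤ t → HasDerivAt f₂ (k t • V (f₂ t)) t := by
      intro t ht
      have h1 : HasDerivAt (fun t : ℝ => u z₀ + (t : ℂ)) 1 t :=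
        (Complex.ofRealCLM.hasDerivAt (x := t)).const_add (u z₀)
      exact (h1.prodMk (hg t ht)).congr_deriv
        (by simp [hV, hf₂, hkpos t ht, hg₀ t ht, div_eq_inv_mul])
    have hc₁ : ContinuousOn f₁ (Icc 0 T) := fun t _ => (hd₁ t).continuousAt.continuousWithinAt
    have hc₂ : ContinuousOn f₂ (Icc 0 T) := fun t ht => (hd₂ t ht.1).continuousAt.continuousWithinAt
    have hcomp : IsCompact (f₁ '' Icc 0 T ∪ f₂ '' Icc 0 T) :=
      (isCompact_Icc.image_of_continuousOn hc₁).union (isCompact_Icc.image_of_continuousOn hc₂)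
    have hVd : ContDiff ℂ 1 V := contDiff_snd.prodMk (hH.contDiff.comp contDiff_fst)
    obtain ⟨K, hK⟩ :=
      hVd.locallyLipschitz.locallyLipschitzOn.exists_lipschitzOnWith_of_compact hcomp
    have := ODE_solution_unique_of_mem_Icc_right (v := fun t p => k t • V p)
      (s := fun _ => f₁ '' Icc 0 T ∪ f₂ '' Icc 0 T) (K := C.toNNReal * K) (f := f₁) (g := f₂)
      (a := 0) (b := T) (fun t ht => ?_) hc₁
      (fun t _ => (hd₁ t).hasDerivWithinAt)
      (fun t ht => Or.inl (mem_image_of_mem _ (Ico_subset_Icc_self ht))) hc₂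
      (fun t ht => (hd₂ t ht.1).hasDerivWithinAt)
      (fun t ht => Or.inr (mem_image_of_mem _ (Ico_subset_Icc_self ht)))
      (by simp [hf₁, hf₂, hΦ0, hinit])
    · exact congrArg Prod.fst (this (right_mem_Icc.2 hT))
    · rw [lipschitzOnWith_iff_dist_le_mul] at hK ⊢
      intro x hx y hy
      rw [dist_smul₀, NNReal.coe_mul, Real.coe_toNNReal C hC, mul_assoc]
      exact mul_le_mul (hkn t ht.1) (hK x hx y hy) dist_nonneg hC
  obtain ⟨M, hM⟩ := (isCompact_closedBall z₀ (2 * C)).exists_bound_of_continuousOn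
    hu.continuous.continuousOn
  set T : ℝ := |M| + ‖u z₀‖ + 1
  have hT : 0 ≤ T := by positivity
  have h1 := hM (Φ T) (by simpa [dist_eq_norm] using hΦb T hT)
  rw [key T hT] at h1
  have h2 : ‖(T : ℂ)‖ ≤ ‖u z₀ + T‖ + ‖u z₀‖ := by
    simpa using norm_sub_le (u z₀ + T) (u z₀)
  rw [Complex.norm_real, Real.norm_of_nonneg hT] at h2
  have := le_abs_self M
  simp only [T] at h2 h1
  linarith

theorem exists_dist_lt_of_differentiable {u : ℂ → ℂ} (hu : Differentiable ℂ u)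
    (hnc : ¬ ∃ c, ∀ z, u z = c) (a : ℂ) : ∃ z, ‖u z - a‖ < 1 := by
  by_contra! h
  have hne : ∀ z, u z - a ≠ 0 := fun z hz => by
    have := h z
    simp [hz] at this
    linarith
  have hd : Differentiable ℂ fun z => (u z - a)⁻¹ := (hu.sub_const a).inv hne
  have hb : Bornology.IsBounded (range fun z => (u z - a)⁻¹) := by
    refine isBounded_iff_forall_norm_le.2 ⟨1, ?_⟩
    rintro _ ⟨z, rfl⟩
    rw [norm_inv]
    exact inv_le_one_of_one_le₀ (h z)
  refine hnc ⟨u 0, fun z => ?_⟩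
  have := inv_injective (hd.apply_eq_apply_of_bounded hb z 0)
  exact sub_left_injective this

theorem exists_eq_const_of_sq_deriv_eq {u F H : ℂ → ℂ} (hu : Differentiable ℂ u)
    (hH : Differentiable ℂ H) (hF : ∀ s, HasDerivAt F (2 * H s) s)
    (hode : ∀ z, deriv (deriv u) z = H (u z)) (hfirst : ∀ z, deriv u z ^ 2 = F (u z))
    {b : ℂ} (hb : b ≠ 0) {k : ℕ} (hk : 1 ≤ k)
    (hlim : Tendsto (fun s => F s / (b * Complex.exp (k * s / 2)) ^ 2)
      (comap Complex.re atTop ⊓ 𝓟 {s | |s.im| ≤ 1}) (𝓝 1)) : ∃ c, ∀ z, u z = c := by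
  by_contra hnc
  set q : ℂ → ℂ := fun s => F s / (b * Complex.exp (k * s / 2)) ^ 2 with hq
  have hev : ∀ᶠ s in comap Complex.re atTop ⊓ 𝓟 {s | |s.im| ≤ 1}, ‖q s - 1‖ < 1 / 2 := by
    have := hlim.eventually (Metric.ball_mem_nhds 1 (ε := 1 / 2) (by norm_num))
    simpa [dist_eq_norm] using this
  rw [eventually_inf_principal, eventually_comap] at hev
  obtain ⟨R, hR⟩ := eventually_atTop.1 hev
  obtain ⟨z₀, hz₀⟩ := exists_dist_lt_of_differentiable hu hnc ((|R| + 1 : ℝ) : ℂ)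
  have hre : |R| ≤ (u z₀).re := by
    have := (abs_le.1 ((Complex.abs_re_le_norm _).trans hz₀.le)).1
    simp at this
    linarith
  have him : |(u z₀).im| ≤ 1 := by
    simpa using (Complex.abs_im_le_norm _).trans hz₀.le
  have hqs : ∀ t : ℝ, 0 ≤ t → ‖q (u z₀ + t) - 1‖ < 1 / 2 := fun t ht =>
    hR (u z₀ + t).re (by simp; linarith [le_abs_self R]) _ rfl (by simpa using him)
  have hE : ∀ s, b * Complex.exp (k * s / 2) ≠ 0 := fun s =>
    mul_ne_zero hb (Complex.exp_ne_zero _)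
  have hqd : Differentiable ℂ q := fun s =>
    (hF s).differentiableAt.div (by fun_prop) (pow_ne_zero 2 (hE s))
  have hsq : ∀ s : ℂ, (s ^ (1 / 2 : ℂ)) ^ 2 = s := fun s => by
    rw [← Complex.cpow_nat_mul]; simp
  set G : ℂ → ℂ := fun s => b * Complex.exp (k * s / 2) * (q s) ^ (1 / 2 : ℂ) with hG
  have hGsq : ∀ s, G s ^ 2 = F s := fun s => by
    simp only [hG]
    rw [mul_pow, hsq, hq, mul_div_cancel₀ _ (pow_ne_zero 2 (hE s))]
  obtain ⟨σ, hσ, hσG⟩ : ∃ σ : ℂ, σ ^ 2 = 1 ∧ σ * G (u z₀) = deriv u z₀ := by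
    have h : deriv u z₀ ^ 2 = G (u z₀) ^ 2 := by rw [hfirst, hGsq]
    rcases sq_eq_sq_iff_eq_or_eq_neg.1 h with h | h
    · exact ⟨1, by norm_num, by simp [h]⟩
    · exact ⟨-1, by norm_num, by simp [h]⟩
  have hσn : ‖σ‖ = 1 := by
    have : ‖σ‖ ^ 2 = 1 := by rw [← norm_pow, hσ, norm_one]
    exact (pow_eq_one_iff_of_nonneg (norm_nonneg _) two_ne_zero).1 this
  have hroot : ∀ t : ℝ, 0 ≤ t → 1 / 2 ≤ ‖q (u z₀ + t) ^ (1 / 2 : ℂ)‖ := by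
    intro t ht
    have h1 : 1 / 2 ≤ ‖q (u z₀ + t)‖ := by
      have := norm_sub_norm_le (1 : ℂ) (q (u z₀ + t))
      rw [norm_sub_rev, norm_one] at this
      linarith [hqs t ht]
    have h2 : ‖q (u z₀ + t) ^ (1 / 2 : ℂ)‖ ^ 2 = ‖q (u z₀ + t)‖ := by rw [← norm_pow, hsq]
    nlinarith [norm_nonneg (q (u z₀ + t) ^ (1 / 2 : ℂ))]
  have hlow : ∀ t : ℝ, 0 ≤ t → ‖b‖ / 2 * Real.exp (t / 2) ≤ ‖σ * G (u z₀ + t)‖ := by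
    intro t ht
    have hexp : Real.exp (t / 2) ≤ ‖Complex.exp (k * (u z₀ + t) / 2)‖ := by
      rw [Complex.norm_exp, Real.exp_le_exp]
      have hk' : (1 : ℝ) ≤ k := by exact_mod_cast hk
      have e : ((k : ℂ) * (u z₀ + t) / 2).re = k * ((u z₀).re + t) / 2 := by
        simp
      rw [e]
      have : 0 ≤ (u z₀).re := (abs_nonneg R).trans hre
      nlinarith
    rw [norm_mul, hσn, one_mul, hG, norm_mul, norm_mul]
    calc ‖b‖ / 2 * Real.exp (t / 2) = ‖b‖ * Real.exp (t / 2) * (1 / 2) := by ring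
      _ ≤ _ := by gcongr; exact hroot t ht
  have hbpos : 0 < ‖b‖ := norm_pos_iff.2 hb
  have hne : ∀ t : ℝ, 0 ≤ t → σ * G (u z₀ + t) ≠ 0 := fun t ht =>
    norm_pos_iff.1 ((by positivity : 0 < ‖b‖ / 2 * Real.exp (t / 2)).trans_le (hlow t ht))
  refine false_of_integrable_ray_speed hu hH hode (z₀ := z₀)
    (g := fun t : ℝ => σ * G (u z₀ + t)) (C := 2 / ‖b‖) ?_ hne (by simpa using hσG) ?_
  · intro t ht
    have hslit : q (u z₀ + t) ∈ Complex.slitPlane := by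
      have := (abs_le.1 ((Complex.abs_re_le_norm _).trans (hqs t ht).le)).1
      left
      simp at this
      linarith
    have hGd : DifferentiableAt ℂ G (u z₀ + t) :=
      DifferentiableAt.mul (by fun_prop)
        ((hqd _).cpow_const hslit)
    have h2 := (hGd.hasDerivAt.fun_pow 2).congr_of_eventuallyEq
      (Eventually.of_forall fun s => (hGsq s).symm)
    have h3 := h2.unique (hF _)
    have h4 : HasDerivAt (fun t : ℝ => u z₀ + (t : ℂ)) 1 t :=
      (Complex.ofRealCLM.hasDerivAt (x := t)).const_add (u z₀)
    have h5 := (hGd.hasDerivAt.comp t h4).const_mul σ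
    refine h5.congr_deriv ?_
    rw [mul_one, eq_div_iff (hne t ht)]
    norm_num at h3
    linear_combination (deriv G (u z₀ + t) * G (u z₀ + t)) * hσ + h3 / 2
  · intro t ht
    have e : 2 / ‖b‖ * Real.exp (-t / 2) = (‖b‖ / 2 * Real.exp (t / 2))⁻¹ := by
      rw [mul_inv, inv_div, neg_div, Real.exp_neg]
    rw [e, norm_inv]
    exact inv_anti₀ (by positivity) (hlow t ht)

theorem tendsto_exp_neg_strip :
    Tendsto (fun s => Complex.exp (-s)) (comap Complex.re atTop ⊓ 𝓟 {s | |s.im| ≤ 1}) (𝓝 0) := by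
  refine squeeze_zero_norm (a := fun s => Real.exp (-s.re)) (fun s => ?_) ?_
  · simp [Complex.norm_exp]
  · exact (Real.tendsto_exp_neg_atTop_nhds_zero.comp tendsto_comap).mono_left inf_le_left

theorem tendsto_mul_exp_neg_strip :
    Tendsto (fun s => s * Complex.exp (-s))
      (comap Complex.re atTop ⊓ 𝓟 {s | |s.im| ≤ 1}) (𝓝 0) := by
  refine squeeze_zero_norm' (a := fun s => s.re * Real.exp (-s.re) + Real.exp (-s.re)) ?_ ?_
  · rw [eventually_inf_principal]
    filter_upwards [tendsto_comap.eventually (eventually_ge_atTop (0 : ℝ))] with s hs him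
    rw [norm_mul, Complex.norm_exp, Complex.neg_re, ← add_one_mul]
    gcongr
    refine (Complex.norm_le_abs_re_add_abs_im s).trans ?_
    rw [abs_of_nonneg hs]
    gcongr
  · have h := (Real.tendsto_pow_mul_exp_neg_atTop_nhds_zero 1).add
      Real.tendsto_exp_neg_atTop_nhds_zero
    simpa [Function.comp_def] using (h.comp tendsto_comap).mono_left inf_le_left

theorem exists_eq_const_of_log_hayman {a₀ a₁ a₂ a₃ a₄ : ℂ} (hdeg : a₄ ≠ 0 ∨ (a₄ = 0 ∧ a₃ ≠ 0))
    {u : ℂ → ℂ} (hu : Differentiable ℂ u)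
    (hode : ∀ z, deriv (deriv u) z = -(a₄ * Complex.exp (u z) ^ 2 + a₃ * Complex.exp (u z) + a₂
      + a₁ * Complex.exp (-u z) + a₀ * Complex.exp (-u z) ^ 2)) : ∃ c, ∀ z, u z = c := by
  set H : ℂ → ℂ := fun s => -(a₄ * Complex.exp s ^ 2 + a₃ * Complex.exp s + a₂
      + a₁ * Complex.exp (-s) + a₀ * Complex.exp (-s) ^ 2) with hHdef
  set F₀ : ℂ → ℂ := fun s => -(a₄ * Complex.exp s ^ 2) - 2 * a₃ * Complex.exp s - 2 * a₂ * s
      + 2 * a₁ * Complex.exp (-s) + a₀ * Complex.exp (-s) ^ 2 with hF₀def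
  have hH : Differentiable ℂ H := by fun_prop
  have hF₀ : ∀ s, HasDerivAt F₀ (2 * H s) s := by
    intro s
    have h1 := Complex.hasDerivAt_exp s
    have h2 := (hasDerivAt_neg s).cexp
    have := ((((((h1.fun_pow 2).const_mul a₄).fun_neg).fun_sub (h1.const_mul (2 * a₃))).fun_sub
      ((hasDerivAt_id s).const_mul (2 * a₂))).fun_add (h2.const_mul (2 * a₁))).fun_add
      ((h2.fun_pow 2).const_mul a₀)
    refine this.congr_deriv ?_
    simp only [hHdef]
    norm_num
    ring
  have hu' : Differentiable ℂ (deriv u) := fun z => (hu.analyticAt z).deriv.differentiableAt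
  have hconst : ∀ z, HasDerivAt (fun z => deriv u z ^ 2 - F₀ (u z)) 0 z := by
    intro z
    have := ((hu' z).hasDerivAt.fun_pow 2).fun_sub ((hF₀ (u z)).comp z (hu z).hasDerivAt)
    refine this.congr_deriv ?_
    rw [hode z]
    norm_num
    ring
  obtain ⟨C, hC⟩ : ∃ C, ∀ z, deriv u z ^ 2 = C + F₀ (u z) :=
    ⟨deriv u 0 ^ 2 - F₀ (u 0), fun z => by
      have := is_const_of_deriv_eq_zero (fun z => (hconst z).differentiableAt)
        (fun z => (hconst z).deriv) z 0
      linear_combination this⟩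
  have hF : ∀ s, HasDerivAt (fun s => C + F₀ s) (2 * H s) s := fun s => (hF₀ s).const_add C
  have hE := tendsto_exp_neg_strip
  have hsE := tendsto_mul_exp_neg_strip
  have hinv : ∀ s : ℂ, Complex.exp s * Complex.exp (-s) = 1 := fun s => by
    rw [← Complex.exp_add]; simp
  by_cases h4 : a₄ = 0
  · have h3 : a₃ ≠ 0 := by tauto
    obtain ⟨b, hb⟩ := IsAlgClosed.exists_pow_nat_eq (-(2 * a₃)) two_pos
    have hb0 : b ≠ 0 := by
      rintro rfl
      simp [h3] at hb
    refine exists_eq_const_of_sq_deriv_eq hu hH hF hode hC hb0 (k := 1) le_rfl ?_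
    have hT := (((tendsto_const_nhds (x := (1 : ℂ))).add (hsE.const_mul (a₂ / a₃))).sub
      (hE.const_mul (C / (2 * a₃)))).sub ((hE.pow 2).const_mul (a₁ / a₃)) |>.sub
      ((hE.pow 3).const_mul (a₀ / (2 * a₃)))
    norm_num at hT
    refine hT.congr fun s => ?_
    have hsq : Complex.exp ((1 : ℕ) * s / 2) ^ 2 = Complex.exp s := by
      rw [← Complex.exp_nat_mul]; congr 1; push_cast; ring
    rw [mul_pow, hb, hsq, eq_div_iff (by simp [h3])]
    simp only [hF₀def, h4]
    have := hinv s
    generalize Complex.exp s = x at *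
    generalize Complex.exp (-s) = y at *
    obtain rfl : x = y⁻¹ := eq_inv_of_mul_eq_one_left this
    have hy : y ≠ 0 := right_ne_zero_of_mul_eq_one this
    field_simp
    ring
  · obtain ⟨b, hb⟩ := IsAlgClosed.exists_pow_nat_eq (-a₄) two_pos
    have hb0 : b ≠ 0 := by
      rintro rfl
      simp [h4] at hb
    refine exists_eq_const_of_sq_deriv_eq hu hH hF hode hC hb0 (k := 2) one_le_two ?_
    have hT := (((((tendsto_const_nhds (x := (1 : ℂ))).add (hE.const_mul (2 * a₃ / a₄))).add
      ((hsE.mul hE).const_mul (2 * a₂ / a₄))).sub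
      ((hE.pow 2).const_mul (C / a₄))).sub ((hE.pow 3).const_mul (2 * a₁ / a₄))).sub
      ((hE.pow 4).const_mul (a₀ / a₄))
    norm_num at hT
    refine hT.congr fun s => ?_
    have hsq : Complex.exp ((2 : ℕ) * s / 2) = Complex.exp s := by
      congr 1; push_cast; ring
    rw [mul_pow, hb, hsq, eq_div_iff (by simp [h4])]
    simp only [hF₀def]
    have := hinv s
    generalize Complex.exp s = x at *
    generalize Complex.exp (-s) = y at *
    obtain rfl : x = y⁻¹ := eq_inv_of_mul_eq_one_left this
    have hy : y ≠ 0 := right_ne_zero_of_mul_eq_one this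
    field_simp
    ring

theorem exists_exp_eq_of_differentiable {w : ℂ → ℂ} (hw : Differentiable ℂ w)
    (hne : ∀ z, w z ≠ 0) : ∃ u, Differentiable ℂ u ∧ ∀ z, w z = Complex.exp (u z) := by
  have hw' : Differentiable ℂ (deriv w) := fun z => (hw.analyticAt z).deriv.differentiableAt
  obtain ⟨v, hv₀, hv⟩ := ((hw'.div hw hne).isExactOn_univ).with_val_at 0 (Complex.log (w 0))
  have hd : ∀ z, HasDerivAt (fun z => w z * Complex.exp (-v z)) 0 z := by
    intro z
    have := (hw z).hasDerivAt.fun_mul (hv z trivial).fun_neg.cexp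
    refine this.congr_deriv ?_
    simp only [Pi.div_apply]
    field_simp [hne z]
    ring
  refine ⟨v, fun z => (hv z trivial).differentiableAt, fun z => ?_⟩
  have := is_const_of_deriv_eq_zero (fun z => (hd z).differentiableAt) (fun z => (hd z).deriv) z 0
  simp only [hv₀] at this
  rw [Complex.exp_neg, Complex.exp_neg, Complex.exp_log (hne 0), mul_inv_cancel₀ (hne 0)] at this
  exact eq_of_mul_inv_eq_one this

theorem exists_eq_const_of_hayman_of_ne_zero {a₀ a₁ a₂ a₃ a₄ : ℂ}
    (hdeg : a₄ ≠ 0 ∨ (a₄ = 0 ∧ a₃ ≠ 0)) {w : ℂ → ℂ} (hw : Differentiable ℂ w)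
    (hne : ∀ z, w z ≠ 0)
    (heq : ∀ z : ℂ, w z * deriv (deriv w) z - (deriv w z) ^ 2
        + a₄ * (w z) ^ 4 + a₃ * (w z) ^ 3 + a₂ * (w z) ^ 2 + a₁ * w z + a₀ = 0) :
    ∃ c, ∀ z, w z = c := by
  obtain ⟨u, hu, hwu⟩ := exists_exp_eq_of_differentiable hw hne
  obtain rfl : w = fun z => Complex.exp (u z) := funext hwu
  have hu' : Differentiable ℂ (deriv u) := fun z => (hu.analyticAt z).deriv.differentiableAt
  obtain ⟨c, hc⟩ := exists_eq_const_of_log_hayman (a₀ := a₀) (a₁ := a₁) (a₂ := a₂)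
      hdeg hu fun z => by
    have d1 : deriv (fun z => Complex.exp (u z)) = fun z => Complex.exp (u z) * deriv u z :=
      funext fun z => (hu z).hasDerivAt.cexp.deriv
    have d2 := ((hu z).hasDerivAt.cexp.fun_mul (hu' z).hasDerivAt).deriv
    have h := heq z
    rw [d1, d2] at h
    beta_reduce at h
    have hx := Complex.exp_ne_zero (u z)
    rw [Complex.exp_neg]
    generalize Complex.exp (u z) = x at *
    field_simp
    linear_combination h
  exact ⟨Complex.exp c, fun z => by simp only [hc z]⟩

theorem hasDerivAt_hayman_energy {a₀ a₁ a₂ a₃ a₄ : ℂ} {w : ℂ → ℂ} {z : ℂ} (hw : AnalyticAt ℂ w z)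
    (hz : w z ≠ 0)
    (heq : w z * deriv (deriv w) z - (deriv w z) ^ 2
        + a₄ * (w z) ^ 4 + a₃ * (w z) ^ 3 + a₂ * (w z) ^ 2 + a₁ * w z + a₀ = 0) :
    HasDerivAt (fun z => (deriv w z / w z) ^ 2 + a₄ * (w z) ^ 2 + 2 * a₃ * w z - 2 * a₁ * (w z)⁻¹
      - a₀ * ((w z)⁻¹) ^ 2) (-2 * a₂ * (deriv w z / w z)) z := by
  have h1 : HasDerivAt w (deriv w z) z := hw.differentiableAt.hasDerivAt
  have h2 : HasDerivAt (deriv w) (deriv (deriv w) z) z := hw.deriv.differentiableAt.hasDerivAt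
  have h3 := h1.fun_inv hz
  have := (((((h2.fun_div h1 hz).fun_pow 2).fun_add ((h1.fun_pow 2).const_mul a₄)).fun_add
    (h1.const_mul (2 * a₃))).fun_sub (h3.const_mul (2 * a₁))).fun_sub ((h3.fun_pow 2).const_mul a₀)
  refine this.congr_deriv ?_
  have e : deriv (deriv w) z = ((deriv w z) ^ 2 - (a₄ * (w z) ^ 4 + a₃ * (w z) ^ 3
      + a₂ * (w z) ^ 2 + a₁ * w z + a₀)) / w z := by
    rw [eq_div_iff hz]; linear_combination heq
  rw [e]
  norm_num
  field_simp
  ring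

theorem eq_zero_of_hayman_of_eventuallyEq_zpow_mul {a₀ a₁ a₂ a₃ a₄ : ℂ} (ha₂ : a₂ ≠ 0)
    {w h : ℂ → ℂ} {c : ℂ} {n : ℤ}
    (heq : ∀ z : ℂ, AnalyticAt ℂ w z →
      w z * deriv (deriv w) z - (deriv w z) ^ 2
        + a₄ * (w z) ^ 4 + a₃ * (w z) ^ 3 + a₂ * (w z) ^ 2 + a₁ * w z + a₀ = 0)
    (hw : MeromorphicAt w c) (hh : AnalyticAt ℂ h c) (hhc : h c ≠ 0)
    (hwh : ∀ᶠ z in 𝓝[≠] c, w z = (z - c) ^ n • h z) : n = 0 := by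
  have ev1 : ∀ᶠ z in 𝓝[≠] c, w z = (z - c) ^ n • h z ∧ AnalyticAt ℂ w z :=
    hwh.and hw.eventually_analyticAt
  rw [eventually_nhdsWithin_iff] at ev1
  have ev2 := (ev1.and hh.eventually_analyticAt).and (hh.continuousAt.eventually_ne hhc)
  obtain ⟨ε, hε, H⟩ := Metric.eventually_nhds_iff_ball.1 ev2
  set r := ε / 2 with hr
  have hr0 : 0 < r := by positivity
  have hsub : closedBall c r ⊆ ball c ε := closedBall_subset_ball (by linarith)
  have hlog : ∀ z ∈ sphere c r, w z ≠ 0 ∧ deriv w z / w z = n * (z - c)⁻¹ + deriv h z / h z := by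
    intro z hz
    have hzb := hsub (sphere_subset_closedBall hz)
    have hzc : z ≠ c := ne_of_mem_sphere hz hr0.ne'
    have hzc' : z - c ≠ 0 := sub_ne_zero.2 hzc
    obtain ⟨⟨h1, h2⟩, h3⟩ := H z hzb
    have e : w =ᶠ[𝓝 z] fun z => (z - c) ^ n * h z := by
      filter_upwards [isOpen_ball.mem_nhds hzb, isOpen_ne.mem_nhds hzc] with y hy hyc
      exact ((H y hy).1.1 hyc).1
    have d1 : HasDerivAt (fun z => (z - c) ^ n) (n * (z - c) ^ (n - 1)) z := by
      have := (hasDerivAt_zpow n (z - c) (Or.inl hzc')).comp z ((hasDerivAt_id z).sub_const c)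
      simpa [Function.comp_def] using this
    have d2 := d1.fun_mul h2.differentiableAt.hasDerivAt
    have hn : (z - c) ^ n ≠ 0 := zpow_ne_zero _ hzc'
    refine ⟨by rw [e.eq_of_nhds]; exact mul_ne_zero hn h3, ?_⟩
    rw [e.deriv_eq, d2.deriv, e.eq_of_nhds, zpow_sub_one₀ hzc']
    field_simp
  have I0 := circleIntegral.integral_eq_zero_of_hasDerivWithinAt hr0.le (c := c)
    (fun z hz => (hasDerivAt_hayman_energy
      (((H z (hsub (sphere_subset_closedBall hz))).1.1 (ne_of_mem_sphere hz hr0.ne')).2)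
      (hlog z hz).1 (heq z
      (((H z (hsub (sphere_subset_closedBall hz))).1.1
        (ne_of_mem_sphere hz hr0.ne')).2))).hasDerivWithinAt)
  rw [circleIntegral.integral_const_mul, circleIntegral.integral_congr hr0.le
    (fun z hz => (hlog z hz).2)] at I0
  have hdd : ∀ z ∈ closedBall c r, DifferentiableAt ℂ (fun z => deriv h z / h z) z := by
    intro z hz
    obtain ⟨⟨-, h2⟩, h3⟩ := H z (hsub hz)
    exact h2.deriv.differentiableAt.fun_div h2.differentiableAt h3
  have hcont : ContinuousOn (fun z => deriv h z / h z) (closedBall c r) :=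
    fun z hz => (hdd z hz).continuousAt.continuousWithinAt
  have I1 : (∮ z in C(c, r), deriv h z / h z) = 0 :=
    Complex.circleIntegral_eq_zero_of_differentiable_on_off_countable hr0.le countable_empty
      hcont (fun z hz => hdd z (ball_subset_closedBall hz.1))
  have ci1 : CircleIntegrable (fun z => (n : ℂ) * (z - c)⁻¹) c r := by
    refine ContinuousOn.circleIntegrable hr0.le ?_
    refine continuousOn_const.mul (ContinuousOn.inv₀ (by fun_prop) ?_)
    exact fun z hz => sub_ne_zero.2 (ne_of_mem_sphere hz hr0.ne')
  have ci2 : CircleIntegrable (fun z => deriv h z / h z) c r :=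
    (hcont.mono sphere_subset_closedBall).circleIntegrable hr0.le
  rw [circleIntegral.integral_add ci1 ci2, I1, circleIntegral.integral_const_mul,
    circleIntegral.integral_sub_center_inv c hr0.ne'] at I0
  simpa [ha₂, Real.pi_ne_zero] using I0


/-- Let `P(X) = a₀ + a₁ X + a₂ X² + a₃ X³ + a₄ X⁴` with `a₄ ≠ 0`, or
`a₄ = 0` and `a₃ ≠ 0` (i.e. `deg P = 3` or `4`).  If `w·w'' − (w')² + P(w) = 0` admits a
nonconstant meromorphic solution on `ℂ`, then `a₂ = 0`. -/
theorem hayman_type1_a2_vanishes (a₀ a₁ a₂ a₃ a₄ : ℂ)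
    (hdeg : a₄ ≠ 0 ∨ (a₄ = 0 ∧ a₃ ≠ 0)) (w : ℂ → ℂ)
    (hmero : MeromorphicOn w Set.univ)
    (heq : ∀ z : ℂ, AnalyticAt ℂ w z →
      w z * deriv (deriv w) z - (deriv w z) ^ 2
        + a₄ * (w z) ^ 4 + a₃ * (w z) ^ 3 + a₂ * (w z) ^ 2 + a₁ * w z + a₀ = 0)
    (hnonconst : ¬ ∃ c : ℂ, ∀ z : ℂ, AnalyticAt ℂ w z → w z = c) :
    a₂ = 0 := by
  by_contra ha₂
  set W := toMeromorphicNFOn w univ with hW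
  have hWw : ∀ z, W =ᶠ[𝓝[≠] z] w := fun z => hmero.toMeromorphicNFOn_eq_self_on_nhdsNE trivial
  have hNF : ∀ z, MeromorphicNFAt W z := fun z => meromorphicNFOn_toMeromorphicNFOn w univ trivial
  have hWan : ∀ z, AnalyticAt ℂ w z → W z = w z := fun z hz =>
    ((MeromorphicNFAt.eventuallyEq_nhdsNE_iff_eventuallyEq_nhds (hNF z) hz.meromorphicNFAt).1
      (hWw z)).eq_of_nhds
  have hfin : ∀ z, meromorphicOrderAt w z ≠ ⊤ := by
    intro z hz
    refine hnonconst ⟨0, fun y hy => ?_⟩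
    by_contra hy0
    refine hmero.meromorphicOrderAt_ne_top_of_isPreconnected (x := y) (y := z)
      isPreconnected_univ trivial trivial ?_ hz
    rw [hy.meromorphicNFAt.meromorphicOrderAt_eq_zero_iff.2 hy0]
    exact WithTop.zero_ne_top
  have hord : ∀ z, meromorphicOrderAt w z = 0 := by
    intro z
    obtain ⟨n, hn⟩ := WithTop.ne_top_iff_exists.1 (hfin z)
    obtain ⟨h, hh, hhz, hwh⟩ := (meromorphicOrderAt_eq_int_iff (hmero z trivial)).1 hn.symm
    rw [← hn, eq_zero_of_hayman_of_eventuallyEq_zpow_mul ha₂ heq (hmero z trivial) hh hhz hwh]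
    rfl
  have hordW : ∀ z, meromorphicOrderAt W z = 0 := fun z =>
    (meromorphicOrderAt_congr (hWw z)).trans (hord z)
  have hne : ∀ z, W z ≠ 0 := fun z => (hNF z).meromorphicOrderAt_eq_zero_iff.1 (hordW z)
  have han : ∀ z, AnalyticAt ℂ W z := fun z =>
    (hNF z).meromorphicOrderAt_nonneg_iff_analyticAt.1 (hordW z).ge
  have heqW : ∀ z : ℂ, W z * deriv (deriv W) z - (deriv W z) ^ 2
        + a₄ * (W z) ^ 4 + a₃ * (W z) ^ 3 + a₂ * (W z) ^ 2 + a₁ * W z + a₀ = 0 := by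
    intro z
    have hev : ∀ᶠ y in 𝓝[≠] z, W y * deriv (deriv W) y - (deriv W y) ^ 2
        + a₄ * (W y) ^ 4 + a₃ * (W y) ^ 3 + a₂ * (W y) ^ 2 + a₁ * W y + a₀ = 0 := by
      filter_upwards [(hmero z trivial).eventually_analyticAt] with y hy
      have e : W =ᶠ[𝓝 y] w := (MeromorphicNFAt.eventuallyEq_nhdsNE_iff_eventuallyEq_nhds
        (hNF y) hy.meromorphicNFAt).1 (hWw y)
      rw [e.eq_of_nhds, e.deriv.deriv_eq, e.deriv_eq]
      exact heq y hy
    have hc : ContinuousAt (fun y => W y * deriv (deriv W) y - (deriv W y) ^ 2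
        + a₄ * (W y) ^ 4 + a₃ * (W y) ^ 3 + a₂ * (W y) ^ 2 + a₁ * W y + a₀) z := by
      have c0 := (han z).continuousAt
      have c1 := (han z).deriv.continuousAt
      have c2 := (han z).deriv.deriv.continuousAt
      fun_prop
    exact tendsto_nhds_unique (hc.tendsto.mono_left nhdsWithin_le_nhds)
      (tendsto_const_nhds.congr' (hev.mono fun y hy => hy.symm))
  obtain ⟨c, hc⟩ := exists_eq_const_of_hayman_of_ne_zero hdeg
    (fun z => (han z).differentiableAt) hne heqW
  exact hnonconst ⟨c, fun z hz => (hWan z hz).symm.trans (hc z)⟩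
end

section
/- Let a_0, a_1, a_3, a_4 ∈ ℂ with a_4 ≠ 0 or a_3 ≠ 0. If w is a nonconstant meromorphic solution on ℂ of w·w'' − (w')² + a_4 w⁴ + a_3 w³ + a_1 w + a_0 = 0, then there exists a constant C ∈ ℂ such that (w')² + a_4 w⁴ + 2 a_3 w³ + 2 C w² − 2 a_1 w − a_0 = 0 at every point z ∈ ℂ where w is analytic. -/
/-- At a point where a solution `w` of the differential equation does not vanish, the function
`(w')² + a₄ w⁴ + 2 a₃ w³ − 2 a₁ w − a₀` divided by `w²` has zero derivative. -/
theorem hasDerivAt_firstIntegral_div_sq {a₀ a₁ a₃ a₄ : ℂ} {w : ℂ → ℂ} {z : ℂ}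
    (hw : AnalyticAt ℂ w z) (hz : w z ≠ 0)
    (heq : w z * deriv (deriv w) z - (deriv w z) ^ 2
        + a₄ * (w z) ^ 4 + a₃ * (w z) ^ 3 + a₁ * w z + a₀ = 0) :
    HasDerivAt (fun x ↦ ((deriv w x) ^ 2 + a₄ * (w x) ^ 4 + 2 * a₃ * (w x) ^ 3
      - 2 * a₁ * w x - a₀) / (w x) ^ 2) 0 z := by
  have h1 := hw.differentiableAt.hasDerivAt
  have h2 := hw.deriv.differentiableAt.hasDerivAt
  have h := (((((h2.fun_pow 2).fun_add ((h1.fun_pow 4).const_mul a₄)).fun_add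
    ((h1.fun_pow 3).const_mul (2 * a₃))).fun_sub (h1.const_mul (2 * a₁))).sub_const a₀).fun_div
    (h1.fun_pow 2) (pow_ne_zero 2 hz)
  refine h.congr_deriv ?_
  rw [div_eq_zero_iff]
  left
  push_cast
  linear_combination 2 * w z * deriv w z * heq

/-- If `w` is a nonconstant meromorphic solution on `ℂ` of
`w·w'' − (w')² + a₄ w⁴ + a₃ w³ + a₁ w + a₀ = 0` (with `a₄ ≠ 0` or `a₃ ≠ 0`), then there is a
constant `C` such that `(w')² + a₄ w⁴ + 2 a₃ w³ + 2 C w² − 2 a₁ w − a₀ = 0` at every point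
where `w` is analytic. -/
theorem hayman_type1_first_integral (a₀ a₁ a₃ a₄ : ℂ) (hdeg : a₄ ≠ 0 ∨ a₃ ≠ 0) (w : ℂ → ℂ)
    (hmero : MeromorphicOn w Set.univ)
    (heq : ∀ z : ℂ, AnalyticAt ℂ w z →
      w z * deriv (deriv w) z - (deriv w z) ^ 2
        + a₄ * (w z) ^ 4 + a₃ * (w z) ^ 3 + a₁ * w z + a₀ = 0)
    (hnonconst : ¬ ∃ c : ℂ, ∀ z : ℂ, AnalyticAt ℂ w z → w z = c) :
    ∃ C : ℂ, ∀ z : ℂ, AnalyticAt ℂ w z →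
      (deriv w z) ^ 2 + a₄ * (w z) ^ 4 + 2 * a₃ * (w z) ^ 3 + 2 * C * (w z) ^ 2
        - 2 * a₁ * w z - a₀ = 0 := by
  set V : Set ℂ := {z | AnalyticAt ℂ w z}
  have hVcount : Vᶜ.Countable := by
    simpa using hmero.countable_compl_analyticAt_inter
  have hVconn : IsPreconnected V := by
    simpa using (hVcount.isConnected_compl_of_one_lt_rank (by simp)).isPreconnected
  obtain ⟨z₀, hz₀, hne⟩ : ∃ z, AnalyticAt ℂ w z ∧ w z ≠ 0 := by
    by_contra! h
    exact hnonconst ⟨0, h⟩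
  obtain ⟨r, hr, hball⟩ := Metric.eventually_nhds_iff_ball.1
    (hz₀.eventually_analyticAt.and (hz₀.continuousAt.eventually_ne hne))
  have hderiv : ∀ x ∈ Metric.ball z₀ r, _ := fun x hx ↦
    hasDerivAt_firstIntegral_div_sq (hball x hx).1 (hball x hx).2 (heq x (hball x hx).1)
  obtain ⟨c, hc⟩ := Metric.isOpen_ball.exists_is_const_of_deriv_eq_zero
    (convex_ball z₀ r).isPreconnected
    (fun x hx ↦ (hderiv x hx).differentiableAt.differentiableWithinAt)
    (fun x hx ↦ (hderiv x hx).deriv)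
  refine ⟨-c / 2, fun z hz ↦ ?_⟩
  have hanal : AnalyticOnNhd ℂ (fun x ↦ (deriv w x) ^ 2 + a₄ * (w x) ^ 4 + 2 * a₃ * (w x) ^ 3
      + 2 * (-c / 2) * (w x) ^ 2 - 2 * a₁ * w x - a₀) V := fun x (hx : AnalyticAt ℂ w x) ↦ by
    have := hx.deriv
    fun_prop
  refine hanal.eqOn_zero_of_preconnected_of_eventuallyEq_zero hVconn hz₀ ?_ hz
  filter_upwards [Metric.ball_mem_nhds z₀ hr] with x hx
  have h := hc x hx
  rw [div_eq_iff (pow_ne_zero 2 (hball x hx).2)] at h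
  simp only [Pi.zero_apply]
  linear_combination h
end

section
/- Let P(X) = a_0 + a_1 X + ... + a_k X^k be a polynomial with complex constant coefficients, a_k ≠ 0 and k ≥ 3. Then every entire function w : ℂ → ℂ satisfying w(z)·w''(z) − (w'(z))² + P(w(z)) = 0 for all z ∈ ℂ is constant. -/
open Filter Topology

/-- A continuous real function on `ℂ` cannot have, at all points where it is at least `f z₀ > 0`,
a direction in which it grows at rate at least a fixed multiple of its square. -/
lemma not_forall_exists_growth_direction {f : ℂ → ℝ} (hf : Continuous f) {z₀ : ℂ}
    (h0 : 0 < f z₀) {c : ℝ} (hc : 0 < c)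
    (H : ∀ z, f z₀ ≤ f z → ∃ (v : ℂ) (D : ℝ), ‖v‖ ≤ 1 ∧
      HasDerivAt (fun t : ℝ => f (z + t * v)) D 0 ∧ c * f z ^ 2 ≤ D) : False := by
  set r : ℝ := 2 / (f z₀ * c) with hr
  have hr0 : 0 < r := by positivity
  obtain ⟨z, hz, hmax⟩ := (isCompact_closedBall z₀ r).exists_isMaxOn
    ⟨z₀, Metric.mem_closedBall_self hr0.le⟩
    (f := fun z => (r - ‖z - z₀‖) * f z) (by fun_prop)
  rw [isMaxOn_iff] at hmax
  have hmax0 : r * f z₀ ≤ (r - ‖z - z₀‖) * f z := by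
    simpa using hmax z₀ (Metric.mem_closedBall_self hr0.le)
  have hdr : ‖z - z₀‖ ≤ r := by simpa [dist_eq_norm] using hz
  have hpos : 0 < (r - ‖z - z₀‖) * f z := lt_of_lt_of_le (by positivity) hmax0
  have hd : 0 < r - ‖z - z₀‖ :=
    lt_of_le_of_ne (by linarith) fun h => by rw [← h] at hpos; simp at hpos
  have hfz : 0 < f z := pos_of_mul_pos_right hpos hd.le
  have hfz0 : f z₀ ≤ f z := by
    have h1 : (r - ‖z - z₀‖) * f z ≤ r * f z :=
      mul_le_mul_of_nonneg_right (by linarith [norm_nonneg (z - z₀)]) hfz.le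
    exact le_of_mul_le_mul_left (hmax0.trans h1) hr0
  obtain ⟨v, D, hv, hD, hcD⟩ := H z hfz0
  have hk := ((hasDerivAt_const (0 : ℝ) (r - ‖z - z₀‖)).sub (hasDerivAt_id (0 : ℝ))).mul hD
  have hk0 : 0 < (r - ‖z - z₀‖) * D - f z := by
    have h1 : 2 ≤ (r - ‖z - z₀‖) * f z * c := by
      have : r * f z₀ * c = 2 := by rw [hr]; field_simp
      nlinarith
    have h2 := mul_le_mul_of_nonneg_left hcD hd.le
    nlinarith
  rw [hasDerivAt_iff_tendsto_slope_zero] at hk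
  have hev := hk.eventually (lt_mem_nhds (a := 0) (by simpa [sub_eq_neg_add] using hk0))
  have hev' : ∀ᶠ t : ℝ in 𝓝[>] 0, _ := hev.filter_mono (nhdsGT_le_nhdsNE 0)
  obtain ⟨t, ht, ht0, htd⟩ := (hev'.and (Ioo_mem_nhdsGT hd)).exists
  have ht' := pos_of_mul_pos_right (by simpa only [smul_eq_mul] using ht) (inv_nonneg.2 ht0.le)
  simp at ht'
  have hft : 0 < f (z + t * v) := pos_of_mul_pos_right (hpos.trans ht') (by linarith)
  have hn : ‖z + t * v - z₀‖ ≤ ‖z - z₀‖ + t := by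
    calc ‖z + t * v - z₀‖ = ‖(z - z₀) + t * v‖ := by ring_nf
      _ ≤ ‖z - z₀‖ + ‖(t : ℂ) * v‖ := norm_add_le _ _
      _ ≤ ‖z - z₀‖ + t := by
        rw [norm_mul, Complex.norm_real, Real.norm_of_nonneg ht0.le]
        nlinarith
  have := hmax (z + t * v) (by rw [Metric.mem_closedBall, dist_eq_norm]; linarith)
  nlinarith

lemma Polynomial.exists_mul_norm_pow_le_norm_eval (n : ℕ) (q : Polynomial ℂ) (hq : q ≠ 0)
    (hn : n ≤ q.natDegree) : ∃ c > 0, ∃ R, ∀ z : ℂ, R ≤ ‖z‖ → c * ‖z‖ ^ n ≤ ‖q.eval z‖ := by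
  induction n generalizing q with
  | zero =>
    by_cases h : q.natDegree = 0
    · rw [Polynomial.natDegree_eq_zero] at h
      obtain ⟨x, rfl⟩ := h
      exact ⟨‖x‖, by simpa using hq, 0, by simp⟩
    · have h1 := q.tendsto_norm_atTop (Polynomial.natDegree_pos_iff_degree_pos.1
        (Nat.pos_of_ne_zero h)) (tendsto_comap (f := fun z : ℂ => ‖z‖) (x := atTop))
      have h2 := h1.eventually_ge_atTop 1
      rw [eventually_comap] at h2
      obtain ⟨R, hR⟩ := eventually_atTop.1 h2
      exact ⟨1, one_pos, R, fun z hz => by simpa using hR _ hz z rfl⟩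
  | succ n ih =>
    have hd : q.divX.natDegree = q.natDegree - 1 := Polynomial.natDegree_divX_eq_natDegree_tsub_one
    obtain ⟨c, hc, R, hR⟩ := ih q.divX (by
      intro h
      rw [Polynomial.divX_eq_zero_iff] at h
      rw [h] at hn
      simp at hn) (by omega)
    refine ⟨c / 2, by positivity, max (max R 1) (2 * ‖q.coeff 0‖ / c), fun z hz => ?_⟩
    have hz1 : 1 ≤ ‖z‖ := ((le_max_right _ _).trans (le_max_left _ _)).trans hz
    have hzR := hR z (((le_max_left _ _).trans (le_max_left _ _)).trans hz)
    have hz2 := (le_max_right _ _).trans hz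
    rw [div_le_iff₀ hc] at hz2
    have e : q.eval z = q.divX.eval z * z + q.coeff 0 := by
      conv_lhs => rw [← q.divX_mul_X_add]
      simp
    have h3 : ‖q.divX.eval z * z‖ - ‖q.coeff 0‖ ≤ ‖q.eval z‖ := by
      rw [e]; simpa using norm_sub_norm_le (q.divX.eval z * z) (-q.coeff 0)
    rw [norm_mul] at h3
    have h4 : c * ‖z‖ ^ n * ‖z‖ ≤ ‖q.divX.eval z‖ * ‖z‖ := by gcongr
    have h5 : ‖z‖ * c ≤ c * ‖z‖ ^ n * ‖z‖ := by
      have := one_le_pow₀ hz1 (n := n)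
      have : 0 < c * ‖z‖ := by positivity
      nlinarith
    rw [pow_succ]
    linarith

lemma HasDerivAt.comp_add_ofReal_mul {w : ℂ → ℂ} {w' z : ℂ} (h : HasDerivAt w w' z) (v : ℂ) :
    HasDerivAt (fun t : ℝ => w (z + t * v)) (w' * v) 0 := by
  have h1 : HasDerivAt (fun s : ℂ => z + s * v) v ((0 : ℝ) : ℂ) := by
    simpa using ((hasDerivAt_id ((0 : ℝ) : ℂ)).mul_const v).const_add z
  have h2 : HasDerivAt w w' (z + ((0 : ℝ) : ℂ) * v) := by simpa using h
  exact (HasDerivAt.comp (h₂ := w) (h := fun s : ℂ => z + s * v) _ h2 h1).comp_ofReal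

/-- The logarithmic derivative has nonzero residue at a zero, hence no local primitive. -/
lemma eq_zero_of_hasDerivAt_mul_logDeriv {w F : ℂ → ℂ} {z₁ b : ℂ} (hw : AnalyticAt ℂ w z₁)
    (h0 : w z₁ = 0) (hne : ¬ ∀ᶠ z in 𝓝 z₁, w z = 0)
    (hF : ∀ᶠ z in 𝓝[≠] z₁, HasDerivAt F (b * (deriv w z / w z)) z) : b = 0 := by
  obtain ⟨m, h, hh, hh0, hwh⟩ := hw.exists_eventuallyEq_pow_smul_nonzero_iff.2 hne
  have hm : m ≠ 0 := by
    rintro rfl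
    have := hwh.self_of_nhds
    simp_all
  have hall := (hh.eventually_analyticAt.and
    ((hh.continuousAt.eventually_ne hh0).and hwh.eventually_nhds)).and
    (eventually_nhdsWithin_iff.1 hF)
  obtain ⟨R, hR, hball⟩ := Metric.eventually_nhds_iff_ball.1 hall
  set r := R / 2
  have hr : 0 < r := by positivity
  have hsub : Metric.closedBall z₁ r ⊆ Metric.ball z₁ R :=
    Metric.closedBall_subset_ball (by simp only [r]; linarith)
  have hs : Metric.sphere z₁ r ⊆ Metric.ball z₁ R := Metric.sphere_subset_closedBall.trans hsub
  have hsne : ∀ z ∈ Metric.sphere z₁ r, z ≠ z₁ := fun z hz => Metric.ne_of_mem_sphere hz hr.ne'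
  have hd : DifferentiableOn ℂ (fun z => b * (deriv h z / h z)) (Metric.closedBall z₁ r) :=
    fun z hz => by
      have := (hball z (hsub hz)).1
      exact ((this.1.deriv.differentiableAt.div this.1.differentiableAt
        this.2.1).const_mul b).differentiableWithinAt
  have hI1 : (∮ z in C(z₁, r), b * (deriv h z / h z)) = 0 := by
    refine (DifferentiableOn.diffContOnCl ?_).circleIntegral_eq_zero hr.le
    rwa [closure_ball _ hr.ne']
  have hI2 : (∮ z in C(z₁, r), b * (deriv w z / w z)) = 0 :=
    circleIntegral.integral_eq_zero_of_hasDerivWithinAt hr.le fun z hz =>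
      ((hball z (hs hz)).2 (hsne z hz)).hasDerivWithinAt
  have hc1 : ContinuousOn (fun z => b * m * (z - z₁)⁻¹) (Metric.sphere z₁ r) :=
    continuousOn_const.mul ((continuousOn_id.sub continuousOn_const).inv₀ fun z hz =>
      sub_ne_zero.2 (hsne z hz))
  have hI3 : (∮ z in C(z₁, r), b * (deriv w z / w z)) =
      ∮ z in C(z₁, r), (b * m * (z - z₁)⁻¹ + b * (deriv h z / h z)) := by
    refine circleIntegral.integral_congr hr.le fun z hz => ?_
    obtain ⟨⟨ha, hz0, he⟩, -⟩ := hball z (hs hz)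
    have hz1 : z - z₁ ≠ 0 := sub_ne_zero.2 (hsne z hz)
    have hder : HasDerivAt (fun z => (z - z₁) ^ m • h z) _ z :=
      (((hasDerivAt_id z).sub_const z₁).pow m).mul ha.differentiableAt.hasDerivAt
    have hdw := (hder.congr_of_eventuallyEq he).deriv
    have hwz := he.self_of_nhds
    obtain ⟨j, rfl⟩ := Nat.exists_eq_succ_of_ne_zero hm
    simp only [hdw, hwz, smul_eq_mul, id, Nat.succ_eq_add_one, Nat.add_sub_cancel, Pi.pow_apply]
    field_simp
    ring
  rw [hI2, circleIntegral.integral_add (hc1.circleIntegrable hr.le)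
    ((hd.continuousOn.mono Metric.sphere_subset_closedBall).circleIntegrable hr.le), hI1,
    circleIntegral.integral_const_mul, circleIntegral.integral_sub_center_inv _ hr.ne'] at hI3
  have := Real.pi_ne_zero
  simpa [hm, this] using hI3

/-- An entire function with `|w'|² ≥ c |w|³` wherever `|w|` is large is constant. -/
lemma exists_const_of_norm_pow_three_le {w : ℂ → ℂ} (hw : Differentiable ℂ w)
    {c R : ℝ} (hc : 0 < c) (h : ∀ z, R ≤ ‖w z‖ → c * ‖w z‖ ^ 3 ≤ ‖deriv w z‖ ^ 2) :
    ∃ a, ∀ z, w z = a := by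
  by_cases hb : ∃ M, ∀ z, ‖w z‖ ≤ M
  · obtain ⟨M, hM⟩ := hb
    exact ⟨w 0, fun z => hw.apply_eq_apply_of_bounded
      (isBounded_iff_forall_norm_le.2 ⟨M, by rintro _ ⟨z, rfl⟩; exact hM z⟩) z 0⟩
  push Not at hb
  obtain ⟨z₀, hz₀⟩ := hb (max R 0)
  have hz0 : 0 < ‖w z₀‖ := (le_max_right _ _).trans_lt hz₀
  refine (not_forall_exists_growth_direction (f := fun z => √‖w z‖)
    (Real.continuous_sqrt.comp hw.continuous.norm) (z₀ := z₀) (Real.sqrt_pos.2 hz0)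
    (c := √c / 2) (by positivity) fun z hz => ?_).elim
  have hzz : ‖w z₀‖ ≤ ‖w z‖ := (Real.sqrt_le_sqrt_iff (norm_nonneg _)).1 hz
  have hpos : 0 < ‖w z‖ := hz0.trans_le hzz
  have hwz : w z ≠ 0 := norm_pos_iff.1 hpos
  have hz3 := h z (((le_max_left _ _).trans hz₀.le).trans hzz)
  have hd : 0 < ‖deriv w z‖ := by
    have : 0 < ‖deriv w z‖ ^ 2 := lt_of_lt_of_le (by positivity) hz3
    exact (norm_nonneg _).lt_of_ne fun e => by simp [← e] at this
  have hdz : deriv w z ≠ 0 := norm_pos_iff.1 hd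
  set s : ℝ := ‖deriv w z‖ / ‖w z‖ with hs
  refine ⟨w z / deriv w z * s, s / 2 * √‖w z‖, ?_, ?_, ?_⟩
  · rw [norm_mul, norm_div, Complex.norm_real, Real.norm_of_nonneg (by positivity), hs]
    exact le_of_eq (by field_simp)
  · have h1 := ((hw z).hasDerivAt.comp_add_ofReal_mul (w z / deriv w z * s)).norm_sq
    have h2 := (h1.sqrt (by simpa using hwz)).sqrt (by simpa using hwz)
    simp only [Real.sqrt_sq (norm_nonneg _)] at h2
    convert h2 using 1
    have e : deriv w z * (w z / deriv w z * s) = (s : ℝ) • w z := by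
      rw [Complex.real_smul]; field_simp
    rw [e, inner_smul_right]
    simp only [Complex.ofReal_zero, zero_mul, add_zero, real_inner_self_eq_norm_sq]
    have := Real.sq_sqrt hpos.le
    have h0 := Real.sqrt_pos.2 hpos
    field_simp
    rw [this]
  · have e := Real.sq_sqrt hpos.le
    have h0 := Real.sqrt_pos.2 hpos
    set y := √‖w z‖
    have h1 : √c * y ^ 3 ≤ ‖deriv w z‖ := by
      refine abs_le_of_sq_le_sq' ?_ hd.le |>.2
      rw [mul_pow, Real.sq_sqrt hc.le]
      rw [← e] at hz3
      calc _ = c * (y ^ 2) ^ 3 := by ring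
        _ ≤ _ := hz3
    have h2 : √c * y ≤ s := by
      rw [hs, ← e, le_div_iff₀ (by positivity)]
      linarith
    nlinarith

/-- A nonconstant entire function comes within distance `1` of every value. -/
lemma Differentiable.exists_norm_sub_lt_one {g : ℂ → ℂ} (hg : Differentiable ℂ g)
    (hne : ¬ ∃ a, ∀ z, g z = a) (t : ℂ) : ∃ z, ‖g z - t‖ < 1 := by
  by_contra! h
  have h0 : ∀ z, g z - t ≠ 0 := fun z e => by have := h z; simp [e] at this; linarith
  have hd : Differentiable ℂ fun z => (g z - t)⁻¹ := (hg.sub_const t).fun_inv h0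
  refine hne ⟨g 0, fun z => ?_⟩
  have := hd.apply_eq_apply_of_bounded (isBounded_iff_forall_norm_le.2 ⟨1, by
    rintro _ ⟨z, rfl⟩
    simpa using inv_le_one_of_one_le₀ (h z)⟩) z 0
  simpa using this

/-- An entire function with `|g'|² ≥ c |exp g| - B |g|` wherever `|exp g|` is large is constant. -/
lemma exists_const_of_norm_exp_le {g : ℂ → ℂ} (hg : Differentiable ℂ g)
    {c B R : ℝ} (hc : 0 < c) (hB : 0 ≤ B)
    (h : ∀ z, R ≤ Real.exp (g z).re →
      c * Real.exp (g z).re - B * ‖g z‖ ≤ ‖deriv g z‖ ^ 2) :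
    ∃ a, ∀ z, g z = a := by
  by_contra hne
  set M := max (max R 1) (6 * B / c)
  have hM1 : 1 ≤ M := (le_max_right _ _).trans (le_max_left _ _)
  have hMR : R ≤ M := (le_max_left _ _).trans (le_max_left _ _)
  have hMB : 6 * B ≤ M * c := (div_le_iff₀ hc).1 (le_max_right _ _)
  obtain ⟨z₀, hz₀⟩ := hg.exists_norm_sub_lt_one hne ((2 * Real.log (2 * M) + 1 : ℝ) : ℂ)
  have hf0 : M ≤ Real.exp ((g z₀).re / 2) / (1 + (g z₀).im ^ 2) := by
    have h1 := (Complex.abs_re_le_norm _).trans_lt hz₀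
    have h2 := (Complex.abs_im_le_norm _).trans_lt hz₀
    rw [Complex.sub_re, Complex.ofReal_re, abs_lt] at h1
    rw [Complex.sub_im, Complex.ofReal_im, sub_zero] at h2
    have h3 : (g z₀).im ^ 2 < 1 := (sq_lt_one_iff_abs_lt_one _).2 h2
    have h4 : 2 * M ≤ Real.exp ((g z₀).re / 2) := by
      rw [← Real.log_le_iff_le_exp (by positivity)]
      linarith
    rw [le_div_iff₀ (by positivity)]
    nlinarith
  refine not_forall_exists_growth_direction
    (f := fun z => Real.exp ((g z).re / 2) / (1 + (g z).im ^ 2)) ?_ (z₀ := z₀)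
    (by positivity) (c := √c / 4) (by positivity) fun z hz => ?_
  · have := hg.continuous
    exact Continuous.div (by fun_prop) (by fun_prop) fun z => by positivity
  set y := Real.exp ((g z).re / 2) with hy
  have hyM : M * (1 + (g z).im ^ 2) ≤ y := (le_div_iff₀ (by positivity)).1 (hf0.trans hz)
  have hMy : M ≤ y := by nlinarith [sq_nonneg (g z).im]
  have hy2 : Real.exp (g z).re = y ^ 2 := by
    rw [hy, ← Real.exp_nat_mul]; congr 1; push_cast; ring
  have him : |(g z).im| ≤ y := by
    nlinarith [sq_nonneg (|(g z).im| - 1), sq_abs (g z).im, sq_nonneg (g z).im]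
  have hre : |(g z).re| ≤ 2 * y := by
    have h1 : 0 ≤ (g z).re / 2 := by
      rw [← Real.one_le_exp_iff]; exact hM1.trans hMy
    have h2 := Real.add_one_le_exp ((g z).re / 2)
    rw [abs_of_nonneg (by linarith)]
    linarith
  have hn : ‖g z‖ ≤ 3 * y := (Complex.norm_le_abs_re_add_abs_im _).trans (by linarith)
  have hs := h z (by rw [hy2]; nlinarith)
  rw [hy2] at hs
  have hy0 : 0 < y := by positivity
  have hs2 : (√c / 2 * y) ^ 2 ≤ ‖deriv g z‖ ^ 2 := by
    rw [mul_pow, div_pow, Real.sq_sqrt hc.le]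
    have h1 : B * ‖g z‖ ≤ B * (3 * y) := by gcongr
    have h2 : M * c * y ≤ y * c * y := by gcongr
    nlinarith [mul_le_mul_of_nonneg_right hMB hy0.le, mul_pos hc (pow_pos hy0 2)]
  have hs3 : √c / 2 * y ≤ ‖deriv g z‖ := (abs_le_of_sq_le_sq' hs2 (norm_nonneg _)).2
  have hdz : deriv g z ≠ 0 := norm_pos_iff.1 (lt_of_lt_of_le (by positivity) hs3)
  refine ⟨‖deriv g z‖ / deriv g z, ‖deriv g z‖ / 2 * (y / (1 + (g z).im ^ 2)), ?_, ?_, ?_⟩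
  · simp [hdz]
  · have h1 := (hg z).hasDerivAt.comp_add_ofReal_mul (‖deriv g z‖ / deriv g z)
    rw [mul_div_cancel₀ _ hdz] at h1
    have hr := Complex.reCLM.hasFDerivAt.comp_hasDerivAt (0 : ℝ) h1
    have hi := Complex.imCLM.hasFDerivAt.comp_hasDerivAt (0 : ℝ) h1
    have h2 := ((hr.div_const 2).exp).div ((hi.pow 2).const_add 1)
      (by simp only [Function.comp, Complex.imCLM_apply, Pi.pow_apply]; positivity)
    refine h2.congr_deriv ?_
    simp [← hy]
    field_simp
  · have hp : 1 ≤ 1 + (g z).im ^ 2 := by nlinarith [sq_nonneg (g z).im]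
    have hq : y / (1 + (g z).im ^ 2) ≤ y := div_le_self hy0.le hp
    have hq0 : 0 < y / (1 + (g z).im ^ 2) := by positivity
    have h5 : √c / 4 * (y / (1 + (g z).im ^ 2)) ≤ ‖deriv g z‖ / 2 := by
      have : √c / 4 * (y / (1 + (g z).im ^ 2)) ≤ √c / 4 * y := by gcongr
      linarith
    calc _ = √c / 4 * (y / (1 + (g z).im ^ 2)) * (y / (1 + (g z).im ^ 2)) := by ring
      _ ≤ _ := mul_le_mul_of_nonneg_right h5 hq0.le

/-- The polynomial part of the primitive `-2 X² ∫ P(X) / X³`, that is, without its logarithm. -/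
noncomputable def firstIntegralPoly (k : ℕ) (a : ℕ → ℂ) : Polynomial ℂ :=
  ∑ n ∈ Finset.range (k + 1), Polynomial.monomial n (if n = 2 then 0 else -2 * a n / (n - 2))

lemma coeff_firstIntegralPoly_add_ne_zero {k : ℕ} {a : ℕ → ℂ} (hak : a k ≠ 0) (hk : 3 ≤ k)
    (t : ℂ) : (firstIntegralPoly k a + Polynomial.monomial 2 t).coeff k ≠ 0 := by
  have h2 : (k : ℂ) - 2 ≠ 0 := by
    rw [sub_ne_zero]; exact_mod_cast (by omega : k ≠ 2)
  have h3 : k ≠ 2 := by omega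
  simp [firstIntegralPoly, Polynomial.finsetSum_coeff, Polynomial.coeff_monomial, h3, h3.symm, hak, h2]

lemma eval_derivative_firstIntegralPoly_mul {k : ℕ} (a : ℕ → ℂ) (hk : 3 ≤ k) (x : ℂ) :
    (firstIntegralPoly k a).derivative.eval x * x = 2 * (firstIntegralPoly k a).eval x
      - 2 * ∑ n ∈ Finset.range (k + 1), a n * x ^ n + 2 * a 2 * x ^ 2 := by
  have h2 : a 2 * x ^ 2 = ∑ n ∈ Finset.range (k + 1), if n = 2 then a n * x ^ n else 0 := by
    rw [Finset.sum_ite_eq' _ 2 (fun n => a n * x ^ n), if_pos (by simp; omega)]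
  rw [mul_assoc 2 (a 2), h2, firstIntegralPoly, Polynomial.derivative_sum,
    Polynomial.eval_finsetSum, Polynomial.eval_finsetSum, Finset.sum_mul, Finset.mul_sum,
    Finset.mul_sum, Finset.mul_sum, ← Finset.sum_sub_distrib, ← Finset.sum_add_distrib]
  refine Finset.sum_congr rfl fun n _ => ?_
  rw [Polynomial.derivative_monomial, Polynomial.eval_monomial, Polynomial.eval_monomial]
  split_ifs with h
  · subst h; simp
  · have h3 : (n : ℂ) - 2 ≠ 0 := by rw [sub_ne_zero]; exact_mod_cast h
    rcases n with _ | n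
    · simp
    · simp only [Nat.add_sub_cancel]
      field_simp
      ring


/-- Let `P(X) = a 0 + ⋯ + a k • X^k` with `a k ≠ 0` and `k ≥ 3`.  Then every
entire function `w` satisfying `w·w'' − (w')² + P(w) = 0` on all of `ℂ` is constant. -/
theorem hayman_type1_entire_constant (k : ℕ) (a : ℕ → ℂ) (hak : a k ≠ 0) (hk : 3 ≤ k)
    (w : ℂ → ℂ) (hentire : Differentiable ℂ w)
    (heq : ∀ z : ℂ,
      w z * deriv (deriv w) z - (deriv w z) ^ 2
        + ∑ n ∈ Finset.range (k + 1), a n * (w z) ^ n = 0) :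
    ∃ c : ℂ, ∀ z : ℂ, w z = c := by
  by_contra hne
  have hw' : Differentiable ℂ (deriv w) := fun z =>
    (hentire.analyticAt z).deriv.differentiableAt
  set Q := firstIntegralPoly k a with hQ
  have hgrowth (t : ℂ) : ∃ c > 0, ∃ R, ∀ x : ℂ, R ≤ ‖x‖ →
      c * ‖x‖ ^ 3 ≤ ‖Q.eval x + t * x ^ 2‖ := by
    have hcoeff := coeff_firstIntegralPoly_add_ne_zero hak hk t
    have := Polynomial.exists_mul_norm_pow_le_norm_eval 3 _
      (fun h => by simp [h] at hcoeff) (hk.trans (Polynomial.le_natDegree_of_ne_zero hcoeff))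
    simpa [Polynomial.eval_monomial] using this
  set E : ℂ → ℂ := fun z => deriv w z ^ 2 - Q.eval (w z) with hE
  have hEd : Differentiable ℂ E := (hw'.pow 2).sub (Q.differentiable.comp hentire)
  set F : ℂ → ℂ := fun z => E z / w z ^ 2
  have hF (z : ℂ) (hz : w z ≠ 0) : HasDerivAt F (-2 * a 2 * (deriv w z / w z)) z := by
    have h1 := (((hw' z).hasDerivAt.pow 2).sub
      ((Q.hasDerivAt (w z)).comp z (hentire z).hasDerivAt)).div
      ((hentire z).hasDerivAt.pow 2) (pow_ne_zero 2 hz)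
    refine h1.congr_deriv ?_
    have h2 := heq z
    have h3 := eval_derivative_firstIntegralPoly_mul a hk (w z)
    rw [← hQ] at h3
    simp only [Pi.sub_apply, Pi.pow_apply, Function.comp]
    field_simp
    push_cast
    linear_combination (2 * deriv w z * w z) * h2 - deriv w z * w z * h3
  have hnz (z₁ : ℂ) : ¬ ∀ᶠ z in 𝓝 z₁, w z = 0 := fun h => hne ⟨0, fun z => congrFun
    (AnalyticOnNhd.eq_of_eventuallyEq (g := 0) (fun z _ => hentire.analyticAt z)
      (fun z _ => analyticAt_const) h) z⟩
  by_cases ha2 : a 2 = 0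
  · obtain ⟨z₁, hz₁⟩ : ∃ z, w z ≠ 0 := by
      by_contra! h
      exact hne ⟨0, h⟩
    obtain ⟨r, hr, hball⟩ := Metric.eventually_nhds_iff_ball.1
      (hentire.continuous.continuousAt.eventually_ne hz₁)
    have hEw : E = fun z => F z₁ * w z ^ 2 := by
      refine AnalyticOnNhd.eq_of_eventuallyEq (z₀ := z₁) (fun z _ => hEd.analyticAt z)
        (fun z _ => ((hentire.pow 2).const_mul _).analyticAt z) ?_
      filter_upwards [Metric.ball_mem_nhds z₁ hr] with z hz
      have hc : F z = F z₁ := Metric.isOpen_ball.is_const_of_deriv_eq_zero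
        (convex_ball z₁ r).isPreconnected
        (fun x hx => (hF x (hball x hx)).differentiableAt.differentiableWithinAt)
        (fun x hx => by rw [(hF x (hball x hx)).deriv]; simp [ha2]) hz
        (Metric.mem_ball_self hr)
      rw [← hc]
      have := hball z hz
      simp only [F]
      field_simp
    obtain ⟨c, hc, R, hR⟩ := hgrowth (F z₁)
    refine hne (exists_const_of_norm_pow_three_le hentire hc (R := R) fun z hz => ?_)
    have h1 : deriv w z ^ 2 = Q.eval (w z) + F z₁ * w z ^ 2 := by
      linear_combination congrFun hEw z
    rw [← norm_pow (deriv w z), h1]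
    exact hR _ hz
  · have hw0 (z₁ : ℂ) : w z₁ ≠ 0 := fun h0 => by
      refine ha2 ?_
      have han := hentire.analyticAt z₁
      have := eq_zero_of_hasDerivAt_mul_logDeriv (F := F) (b := -2 * a 2) han h0 (hnz z₁)
        ((han.eventually_eq_zero_or_eventually_ne_zero.resolve_left (hnz z₁)).mono hF)
      simpa using this
    set g : ℂ → ℂ := fun z => F z / (-2 * a 2)
    have hg (z : ℂ) : HasDerivAt g (deriv w z / w z) z := by
      refine ((hF z (hw0 z)).div_const (-2 * a 2)).congr_deriv ?_
      field_simp
    have hgd : Differentiable ℂ g := fun z => (hg z).differentiableAt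
    obtain ⟨K, hK⟩ : ∃ K, ∀ z, w z = K * Complex.exp (g z) := by
      have hd (z : ℂ) : HasDerivAt (fun z => w z * Complex.exp (-g z)) 0 z := by
        refine ((hentire z).hasDerivAt.mul (hg z).neg.cexp).congr_deriv ?_
        have := hw0 z
        simp only [Pi.neg_apply]
        field_simp
        ring
      refine ⟨w 0 * Complex.exp (-g 0), fun z => ?_⟩
      rw [← is_const_of_deriv_eq_zero (fun z => (hd z).differentiableAt)
        (fun z => (hd z).deriv) z 0, mul_assoc, ← Complex.exp_add]
      simp
    have hK0 : 0 < ‖K‖ := norm_pos_iff.2 fun h => hw0 0 (by simp [hK, h])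
    obtain ⟨c, hc, R, hR⟩ := hgrowth 0
    obtain ⟨b, hb⟩ := exists_const_of_norm_exp_le hgd (c := c * ‖K‖) (B := ‖2 * a 2‖)
      (R := R / ‖K‖) (by positivity) (norm_nonneg _) fun z hz => by
        have hn : ‖w z‖ = ‖K‖ * Real.exp (g z).re := by rw [hK, norm_mul, Complex.norm_exp]
        have h1 := hR (w z) (by rw [hn]; rwa [div_le_iff₀' hK0] at hz)
        have hwz := hw0 z
        have hwp : 0 < ‖w z‖ := norm_pos_iff.2 hwz
        have h2 : Q.eval (w z) + 0 * w z ^ 2 = w z ^ 2 * (deriv g z ^ 2 + 2 * a 2 * g z) := by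
          rw [(hg z).deriv]
          simp only [g, F, hE]
          field_simp
          ring
        rw [h2, norm_mul, norm_pow] at h1
        have h3 : c * ‖w z‖ ≤ ‖deriv g z ^ 2 + 2 * a 2 * g z‖ := by
          refine le_of_mul_le_mul_left ?_ (pow_pos hwp 2)
          linarith
        have h4 := norm_add_le (deriv g z ^ 2) (2 * a 2 * g z)
        rw [norm_mul (2 * a 2), norm_pow] at h4
        rw [hn] at h3
        linarith
    exact hne ⟨K * Complex.exp b, fun z => by rw [hK, hb]⟩
end

section
/- Let a_0, a_1, a_2 ∈ ℂ and let h : ℂ → ℂ be a nonconstant entire function such that a_0 e^{−2h(z)} + a_1 e^{−h(z)} + a_2 + h''(z) = 0 for all z ∈ ℂ. Then a_0 = 0, a_1 = 0, and h''(z) = −a_2 for all z ∈ ℂ. -/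
open Metric

/-- If the real part of an entire function drops by at most `M` below its value at `c` on a disc
of radius `R`, then its second derivative at `c` is at most `16 M / R²`. -/
theorem norm_deriv_deriv_le_of_re_ge {f : ℂ → ℂ} (hf : Differentiable ℂ f) {c : ℂ} {M R : ℝ}
    (hM : 0 < M) (hR : 0 < R) (hre : ∀ z ∈ ball c R, (f c).re - M ≤ (f z).re) :
    ‖deriv (deriv f) c‖ ≤ 16 * M / R ^ 2 := by
  have hbound : ∀ z ∈ sphere c (R / 2), ‖f z - f c‖ ≤ 2 * M := by
    intro z hz
    have hnorm : ‖z - c‖ = R / 2 := by simpa [dist_eq_norm] using hz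
    have hmem : z - c ∈ ball (0 : ℂ) R := by
      rw [mem_ball_zero_iff, hnorm]
      linarith
    have hdiff : Differentiable ℂ fun w => f c - f (c + w) := by fun_prop
    have hmaps : Set.MapsTo (fun w => f c - f (c + w)) (ball 0 R) {w | w.re ≤ M} := by
      intro w hw
      have := hre (c + w) (by simpa [dist_eq_norm] using hw)
      simp only [Set.mem_ofPred_eq, Complex.sub_re]
      linarith
    have := Complex.borelCaratheodory_zero hM hdiff.differentiableOn hmaps hR hmem (by simp)
    rw [hnorm, add_sub_cancel, norm_sub_rev] at this
    refine this.trans_eq ?_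
    field_simp
    ring
  have hsub : Differentiable ℂ fun z => f z - f c := by fun_prop
  have := Complex.norm_iteratedDeriv_le_of_forall_mem_sphere_norm_le 2 (half_pos hR)
    hsub.diffContOnCl hbound
  have hderiv : deriv (fun z => f z - f c) = deriv f := by
    ext z
    exact deriv_sub_const _
  rw [iteratedDeriv_succ, iteratedDeriv_one, hderiv] at this
  refine this.trans_eq ?_
  norm_num [Nat.factorial]
  field_simp
  ring

/-- The real part of a nonconstant entire function is unbounded below. -/
theorem exists_re_lt_of_nonconstant {f : ℂ → ℂ} (hf : Differentiable ℂ f)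
    (hnonconst : ¬ ∃ c : ℂ, ∀ z : ℂ, f z = c) (B : ℝ) : ∃ z, (f z).re < B := by
  by_contra! hB
  have hexp : Differentiable ℂ fun z => Complex.exp (-f z) := by fun_prop
  obtain ⟨c, hc⟩ := hexp.exists_const_forall_eq_of_bounded <| by
    refine (isBounded_closedBall (x := (0 : ℂ)) (r := Real.exp (-B))).subset ?_
    rintro _ ⟨z, rfl⟩
    simpa [Complex.norm_exp] using hB z
  have hderiv : ∀ z, deriv f z = 0 := by
    intro z
    have h₁ := (hf z).hasDerivAt.neg.cexp.deriv
    have h₂ : deriv (fun z => Complex.exp (-f z)) z = 0 := by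
      rw [funext hc, deriv_const]
    simpa [Complex.exp_ne_zero] using h₁.symm.trans h₂
  exact hnonconst ⟨f 0, fun z => is_const_of_deriv_eq_zero hf hderiv z 0⟩

/-- A nonconstant entire function `f` has points where `exp (-α * Re f)` is arbitrarily large
while `f''` is negligible compared with `exp (-α * Re f) ^ 2`. -/
theorem exists_norm_deriv_deriv_le_exp_re {f : ℂ → ℂ} (hf : Differentiable ℂ f)
    (hnonconst : ¬ ∃ c : ℂ, ∀ z : ℂ, f z = c) {α ε B : ℝ} (hα : 0 < α) (hε : 0 < ε)
    (hB : 1 ≤ B) :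
    ∃ z, B ≤ Real.exp (-α * (f z).re) ∧
      ‖deriv (deriv f) z‖ ≤ ε * Real.exp (-α * (f z).re) ^ 2 := by
  obtain ⟨z₀, hz₀⟩ := exists_re_lt_of_nonconstant hf hnonconst (-(2 * B) / α)
  set v : ℂ → ℝ := fun z => Real.exp (-α * (f z).re) with hv
  have hvz₀ : 2 * B ≤ v z₀ := by
    rw [lt_div_iff₀ hα] at hz₀
    have := Real.add_one_le_exp (-α * (f z₀).re)
    simp only [hv]
    linarith
  obtain ⟨R, hR₁, hRz, hRε⟩ : ∃ R : ℝ, 1 ≤ R ∧ 2 * ‖z₀‖ ≤ R ∧ 64 / (α * ε) ≤ R :=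
    ⟨max 1 (max (2 * ‖z₀‖) (64 / (α * ε))), by simp, by simp, by simp⟩
  have hvc : Continuous v := by
    have := hf.continuous
    fun_prop
  obtain ⟨c, hc, hmax⟩ := (isCompact_closedBall (0 : ℂ) R).exists_isMaxOn
    ⟨0, by simp; linarith⟩
    (show ContinuousOn (fun z => v z * (R - ‖z‖)) _ by fun_prop)
  have hmax' : ∀ z, ‖z‖ ≤ R → v z * (R - ‖z‖) ≤ v c * (R - ‖c‖) := fun z hz =>
    hmax (by simpa using hz)
  have hpos : ∀ z, 0 < v z := fun z => Real.exp_pos _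
  set d := R - ‖c‖ with hd
  have hBR : B * R ≤ v c * d := by
    refine le_trans ?_ (hmax' z₀ (by linarith [norm_nonneg z₀]))
    nlinarith
  have hd_pos : 0 < d := by
    have : 0 < v c * d := by nlinarith
    exact pos_of_mul_pos_right this (hpos c).le
  have hdR : d ≤ R := by linarith [norm_nonneg c]
  refine ⟨c, ?_, ?_⟩
  · have : B * R ≤ v c * R := hBR.trans (mul_le_mul_of_nonneg_left hdR (hpos c).le)
    exact le_of_mul_le_mul_right this (by linarith)
  have hre : ∀ z ∈ ball c (d / 2), (f c).re - 1 / α ≤ (f z).re := by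
    intro z hz
    rw [mem_ball, dist_eq_norm] at hz
    have hz' : ‖z‖ ≤ ‖c‖ + d / 2 := by linarith [norm_sub_norm_le z c]
    have h₁ := hmax' z (by linarith)
    have h₂ : v z * (d / 2) ≤ v z * (R - ‖z‖) :=
      mul_le_mul_of_nonneg_left (by linarith) (hpos z).le
    have h₃ : v z ≤ 2 * v c := by
      refine le_of_mul_le_mul_right ?_ (half_pos hd_pos)
      linarith
    have h₄ : v z ≤ Real.exp (1 + -α * (f c).re) := by
      rw [Real.exp_add]
      refine h₃.trans (mul_le_mul_of_nonneg_right ?_ (hpos c).le)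
      linarith [Real.add_one_le_exp 1]
    have h₅ := Real.exp_le_exp.1 h₄
    rw [sub_le_iff_le_add, ← sub_le_iff_le_add', le_div_iff₀ hα]
    linarith
  refine (norm_deriv_deriv_le_of_re_ge hf (by positivity) (half_pos hd_pos) hre).trans ?_
  have hRv : R ≤ v c * d := by nlinarith
  have h64 : 64 ≤ (v c * d) ^ 2 * (α * ε) := by
    rw [div_le_iff₀ (by positivity)] at hRε
    refine hRε.trans (mul_le_mul_of_nonneg_right ?_ (by positivity))
    nlinarith
  change _ ≤ ε * v c ^ 2
  rw [div_le_iff₀ (by positivity), mul_one_div, div_le_iff₀ hα]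
  linarith


/-- If `h` is a nonconstant entire function with
`a₀ e^{−2h} + a₁ e^{−h} + a₂ + h'' = 0` on `ℂ`, then `a₀ = 0`, `a₁ = 0` and `h'' ≡ −a₂`. -/
theorem borel_exponential_identity (a₀ a₁ a₂ : ℂ) (h : ℂ → ℂ)
    (hentire : Differentiable ℂ h)
    (hnonconst : ¬ ∃ c : ℂ, ∀ z : ℂ, h z = c)
    (heq : ∀ z : ℂ,
      a₀ * Complex.exp (-2 * h z) + a₁ * Complex.exp (-h z) + a₂ + deriv (deriv h) z = 0) :
    a₀ = 0 ∧ a₁ = 0 ∧ ∀ z : ℂ, deriv (deriv h) z = -a₂ := by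
  have ha₀ : a₀ = 0 := by
    by_contra hne
    have hpos : 0 < ‖a₀‖ := norm_pos_iff.2 hne
    obtain ⟨z, hz, hz'⟩ := exists_norm_deriv_deriv_le_exp_re hentire hnonconst one_pos
      (half_pos hpos) (B := 1 + 2 * (‖a₁‖ + ‖a₂‖) / ‖a₀‖)
      (le_add_of_nonneg_right (by positivity))
    have hexp : ‖Complex.exp (-h z)‖ = Real.exp (-1 * (h z).re) := by
      simp [Complex.norm_exp]
    set v := Real.exp (-1 * (h z).re)
    have hv : 1 ≤ v := le_trans (le_add_of_nonneg_right (by positivity)) hz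
    have hlarge : 2 * (‖a₁‖ + ‖a₂‖) < ‖a₀‖ * v := by
      rw [← div_lt_iff₀' hpos]
      linarith
    have hsq : Complex.exp (-2 * h z) = Complex.exp (-h z) ^ 2 := by
      rw [← Complex.exp_nat_mul]
      congr 1
      push_cast
      ring
    have hident : a₀ * Complex.exp (-h z) ^ 2 =
        -(a₁ * Complex.exp (-h z) + a₂ + deriv (deriv h) z) := by
      rw [← hsq]
      linear_combination heq z
    have hle : ‖a₀‖ * v ^ 2 ≤ ‖a₁‖ * v + ‖a₂‖ + ‖deriv (deriv h) z‖ := by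
      rw [← hexp, ← norm_pow, ← norm_mul, ← norm_mul, hident, norm_neg]
      exact norm_add₃_le
    nlinarith [mul_lt_mul_of_pos_right hlarge (zero_lt_one.trans_le hv),
      mul_le_mul_of_nonneg_left hv (norm_nonneg a₂)]
  have ha₁ : a₁ = 0 := by
    by_contra hne
    have hpos : 0 < ‖a₁‖ := norm_pos_iff.2 hne
    obtain ⟨z, hz, hz'⟩ := exists_norm_deriv_deriv_le_exp_re hentire hnonconst one_half_pos
      (half_pos hpos) (B := 1 + 2 * ‖a₂‖ / ‖a₁‖) (le_add_of_nonneg_right (by positivity))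
    have hexp : ‖Complex.exp (-h z)‖ = Real.exp (-(1 / 2) * (h z).re) ^ 2 := by
      rw [Complex.norm_exp, ← Real.exp_nat_mul]
      congr 1
      push_cast
      rw [Complex.neg_re]
      ring
    set v := Real.exp (-(1 / 2) * (h z).re)
    have hv : 1 ≤ v := le_trans (le_add_of_nonneg_right (by positivity)) hz
    have hlarge : 2 * ‖a₂‖ < ‖a₁‖ * v := by
      rw [← div_lt_iff₀' hpos]
      linarith
    have hident : a₁ * Complex.exp (-h z) = -(a₂ + deriv (deriv h) z) := by
      have := heq z
      rw [ha₀] at this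
      linear_combination this
    have hle : ‖a₁‖ * v ^ 2 ≤ ‖a₂‖ + ‖deriv (deriv h) z‖ := by
      rw [← hexp, ← norm_mul, hident, norm_neg]
      exact norm_add_le _ _
    nlinarith [mul_lt_mul_of_pos_right hlarge (zero_lt_one.trans_le hv),
      mul_le_mul_of_nonneg_left hv (norm_nonneg a₂)]
  refine ⟨ha₀, ha₁, fun z => ?_⟩
  have := heq z
  rw [ha₀, ha₁] at this
  linear_combination this
end

section
/- Let c ∈ ℂ and let P(X) = a_0 + a_1 X + ... + a_k X^k be a polynomial with complex constant coefficients and a_k ≠ 0. If the differential equation w'' + c (w')² + P(w) = 0 admits a nonconstant meromorphic solution on ℂ, then k ≤ 4; moreover, if c = 0 then k ≤ 3. -/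
open Filter Topology in
/-- The derivative of `(z - x) ^ m * h z` near `x` is `(z - x) ^ (m - 1) * h₁ z`, with `h₁`
analytic at `x`. -/
theorem exists_deriv_eq_zpow_mul {w h : ℂ → ℂ} {x : ℂ} {m : ℤ} (hh : AnalyticAt ℂ h x)
    (hw : ∀ᶠ z in 𝓝[≠] x, w z = (z - x) ^ m * h z) :
    ∃ h₁ : ℂ → ℂ, AnalyticAt ℂ h₁ x ∧
      ∀ᶠ z in 𝓝[≠] x, deriv w z = (z - x) ^ (m - 1) * h₁ z := by
  refine ⟨fun z => m * h z + (z - x) * deriv h z, ?_, ?_⟩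
  · have := hh.deriv
    fun_prop
  · have hw' := EventuallyEq.nhdsNE_deriv hw
    filter_upwards [hw', eventually_nhdsWithin_of_eventually_nhds hh.eventually_analyticAt,
      self_mem_nhdsWithin] with z hz hza hzx
    have hne : z - x ≠ 0 := sub_ne_zero.mpr hzx
    have hd := ((hasDerivAt_zpow m (z - x) (Or.inl hne)).comp_sub_const z x).mul
      hza.differentiableAt.hasDerivAt
    rw [hz]
    refine hd.deriv.trans ?_
    rw [zpow_sub_one₀ hne]
    field_simp

open Filter Topology in
/-- At a pole of order `p`, the term `a k * w ^ k` cannot be the only one of highest order. -/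
theorem not_pole_of_dominant_degree {c : ℂ} {k p e : ℕ} {a : ℕ → ℂ} (hak : a k ≠ 0)
    {w h : ℂ → ℂ} {x : ℂ} (hh : AnalyticAt ℂ h x) (hhx : h x ≠ 0) (hp : 0 < p)
    (hw : ∀ᶠ z in 𝓝[≠] x, w z = (z - x) ^ (-(p : ℤ)) * h z)
    (heq : ∀ᶠ z in 𝓝[≠] x, deriv (deriv w) z + c * (deriv w z) ^ 2
        + ∑ n ∈ Finset.range (k + 1), a n * (w z) ^ n = 0)
    (he : k * p = e + 1 + (p + 2)) (hc : c = 0 ∨ ∃ d, k * p = d + 1 + (2 * p + 2)) : False := by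
  obtain ⟨h₁, hh₁, hw₁⟩ := exists_deriv_eq_zpow_mul hh hw
  obtain ⟨h₂, hh₂, hw₂⟩ := exists_deriv_eq_zpow_mul hh₁ hw₁
  obtain ⟨d, hd⟩ : ∃ d : ℕ, c = 0 ∨ k * p = d + 1 + (2 * p + 2) := by
    rcases hc with hc | ⟨d, hd⟩
    · exact ⟨0, Or.inl hc⟩
    · exact ⟨d, Or.inr hd⟩
  set G : ℂ → ℂ := fun z => (z - x) ^ (e + 1) * h₂ z + c * (z - x) ^ (d + 1) * h₁ z ^ 2
    + ∑ n ∈ Finset.range (k + 1), a n * (z - x) ^ ((k - n) * p) * h z ^ n with hG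
  have hGc : ContinuousAt G x := by
    have := hh.continuousAt
    have := hh₁.continuousAt
    have := hh₂.continuousAt
    fun_prop
  have hG0 : ∀ᶠ z in 𝓝[≠] x, G z = 0 := by
    filter_upwards [hw, hw₁, hw₂, heq, self_mem_nhdsWithin] with z h0 h1 h2 h3 hzx
    have hne : z - x ≠ 0 := sub_ne_zero.mpr hzx
    rw [h2, h1, h0] at h3
    have key := congrArg (fun t => (z - x) ^ (k * p) * t) h3
    simp only [mul_zero, mul_add, Finset.mul_sum] at key
    rw [← key, hG]
    refine congrArg₂ _ (congrArg₂ _ ?_ ?_) (Finset.sum_congr rfl fun n hn => ?_)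
    · rw [← mul_assoc, ← zpow_natCast, ← zpow_natCast, ← zpow_add₀ hne, he]
      congr 2
      push_cast
      ring
    · rcases hd with hd | hd
      · simp [hd]
      · rw [mul_pow, ← zpow_natCast (_ ^ (_ : ℤ)) 2, ← zpow_mul, mul_left_comm, ← mul_assoc,
          mul_assoc, mul_assoc, ← mul_assoc (_ ^ (k * p)), ← zpow_natCast _ (k * p),
          ← zpow_natCast _ (d + 1), ← zpow_add₀ hne, hd]
        congr 3
        push_cast
        ring
    · obtain ⟨j, rfl⟩ := Nat.exists_eq_add_of_le (Nat.lt_succ_iff.mp (Finset.mem_range.mp hn))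
      rw [mul_pow, ← zpow_natCast (_ ^ (_ : ℤ)) n, ← zpow_mul, mul_left_comm, mul_assoc,
        ← mul_assoc (_ ^ ((n + j) * p)), ← zpow_natCast _ ((n + j) * p),
        ← zpow_natCast _ ((n + j - n) * p), ← zpow_add₀ hne, Nat.add_sub_cancel_left]
      congr 3
      push_cast
      ring
  have hGx : G x = 0 := tendsto_nhds_unique (hGc.tendsto.mono_left nhdsWithin_le_nhds)
    (tendsto_const_nhds.congr' (hG0.mono fun z hz => hz.symm))
  have hsum : ∑ n ∈ Finset.range (k + 1), a n * (x - x) ^ ((k - n) * p) * h x ^ n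
      = a k * h x ^ k := by
    rw [Finset.sum_range_succ, Finset.sum_eq_zero]
    · simp
    · intro n hn
      have : (k - n) * p ≠ 0 :=
        (Nat.mul_pos (Nat.sub_pos_of_lt (Finset.mem_range.mp hn)) hp).ne'
      simp [this]
  simp only [hG, hsum] at hGx
  simp [hak, hhx] at hGx

/-- If `‖f‖ ^ 4` is controlled by `‖f'' + c f'²‖` wherever the entire function `f` is large,
then `f` is constant. -/
theorem exists_const_of_pow_four_le {f : ℂ → ℂ} (hf : Differentiable ℂ f)
    {c : ℂ} {K R : ℝ} (hK : 0 ≤ K)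
    (h : ∀ z, R ≤ ‖f z‖ → ‖f z‖ ^ 4 ≤ K * ‖deriv (deriv f) z + c * deriv f z ^ 2‖) :
    ∃ C, ∀ z, f z = C := by
  by_contra hcon
  have hunb : ∀ m : ℝ, ∃ z, m ≤ ‖f z‖ := by
    intro m
    by_contra! hm
    refine hcon (hf.exists_const_forall_eq_of_bounded ?_)
    refine isBounded_iff_forall_norm_le.mpr ⟨m, ?_⟩
    rintro _ ⟨z, rfl⟩
    exact (hm z).le
  set L := K * (2 + ‖c‖) with hL
  have hL0 : 0 ≤ L := by positivity
  obtain ⟨m, hm1, hmR, hmL⟩ : ∃ m : ℝ, 1 ≤ m ∧ R ≤ m ∧ 16 * L < m :=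
    ⟨max (max 1 R) (16 * L + 1), by simp, by simp, by simp⟩
  have step : ∀ (n : ℕ) (z : ℂ), m * 4 ^ n ≤ ‖f z‖ →
      ∃ z' ∈ Metric.sphere z ((1 / 2) ^ n), m * 4 ^ (n + 1) ≤ ‖f z'‖ := by
    intro n z hz
    by_contra! hlt
    set B : ℝ := m * 4 ^ (n + 1) with hB
    have h4 : (1 : ℝ) ≤ 4 ^ n := one_le_pow₀ (by norm_num)
    have hB1 : 1 ≤ B := one_le_mul_of_one_le_of_one_le hm1 (one_le_pow₀ (by norm_num))
    have hδ : (0 : ℝ) < (1 / 2) ^ n := by positivity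
    have hδ2 : (((1 / 2 : ℝ) ^ n) ^ 2)⁻¹ = 4 ^ n := by
      rw [← pow_mul, mul_comm, pow_mul, ← inv_pow]
      norm_num
    have d1 := Complex.norm_deriv_le_of_forall_mem_sphere_norm_le hδ hf.diffContOnCl
      (fun y hy => (hlt y hy).le)
    have d2 := Complex.norm_iteratedDeriv_le_of_forall_mem_sphere_norm_le 2 hδ hf.diffContOnCl
      (fun y hy => (hlt y hy).le)
    rw [iteratedDeriv_succ, iteratedDeriv_one] at d2
    have d1' : ‖deriv f z‖ ^ 2 ≤ B ^ 2 * 4 ^ n := by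
      calc ‖deriv f z‖ ^ 2 ≤ (B / (1 / 2) ^ n) ^ 2 := by gcongr
        _ = B ^ 2 * 4 ^ n := by rw [div_pow, div_eq_mul_inv, hδ2]
    have d2' : ‖deriv (deriv f) z‖ ≤ 2 * B ^ 2 * 4 ^ n := by
      refine d2.trans ?_
      rw [div_eq_mul_inv, hδ2]
      gcongr
      · norm_num
      · nlinarith
    have hup : ‖deriv (deriv f) z + c * deriv f z ^ 2‖ ≤ (2 + ‖c‖) * (B ^ 2 * 4 ^ n) := by
      refine (norm_add_le _ _).trans ?_
      rw [norm_mul, norm_pow]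
      have := mul_le_mul_of_nonneg_left d1' (norm_nonneg c)
      linarith
    have hRz : R ≤ ‖f z‖ := hmR.trans ((le_mul_of_one_le_right (by linarith) h4).trans hz)
    have hbig : (m * 4 ^ n) ^ 4 ≤ L * (B ^ 2 * 4 ^ n) := by
      calc (m * 4 ^ n) ^ 4 ≤ ‖f z‖ ^ 4 := by gcongr
        _ ≤ K * ‖deriv (deriv f) z + c * deriv f z ^ 2‖ := h z hRz
        _ ≤ K * ((2 + ‖c‖) * (B ^ 2 * 4 ^ n)) := by gcongr
        _ = L * (B ^ 2 * 4 ^ n) := by rw [hL]; ring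
    have hB' : B = 4 * (m * 4 ^ n) := by rw [hB]; ring
    rw [hB'] at hbig
    set t : ℝ := 4 ^ n
    have hpos : 0 < m ^ 2 * t ^ 3 := by positivity
    have h1 : m ^ 2 * t ≤ 16 * L := by
      refine le_of_mul_le_mul_left ?_ hpos
      linarith [show m ^ 2 * t ^ 3 * (m ^ 2 * t) = (m * t) ^ 4 by ring,
        show m ^ 2 * t ^ 3 * (16 * L) = L * ((4 * (m * t)) ^ 2 * t) by ring]
    nlinarith
  obtain ⟨z₀, hz₀⟩ := hunb m
  have chain : ∀ n : ℕ, ∃ z, dist z z₀ ≤ 2 - 2 * (1 / 2) ^ n ∧ m * 4 ^ n ≤ ‖f z‖ := by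
    intro n
    induction n with
    | zero => exact ⟨z₀, by simp, by simpa using hz₀⟩
    | succ n ih =>
      obtain ⟨z, hz, hfz⟩ := ih
      obtain ⟨z', hz', hfz'⟩ := step n z hfz
      refine ⟨z', ?_, hfz'⟩
      have := dist_triangle z' z z₀
      rw [Metric.mem_sphere] at hz'
      rw [pow_succ]
      linarith
  obtain ⟨M, hM⟩ := (isCompact_closedBall z₀ 2).exists_bound_of_continuousOn
    hf.continuous.continuousOn
  obtain ⟨n, hn⟩ := pow_unbounded_of_one_lt M (by norm_num : (1 : ℝ) < 4)
  obtain ⟨z, hz, hfz⟩ := chain n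
  have h1 := hM z (Metric.mem_closedBall.mpr (hz.trans (by simp)))
  have h2 : (4 : ℝ) ^ n ≤ m * 4 ^ n := le_mul_of_one_le_left (by positivity) hm1
  linarith

/-- An entire solution of `w'' + c (w')² + P(w) = 0` with `deg P ≥ 4` is constant. -/
theorem exists_const_of_deriv_deriv_add_eq_zero {f : ℂ → ℂ}
    (hf : Differentiable ℂ f) {c : ℂ} {k : ℕ} {a : ℕ → ℂ} (hak : a k ≠ 0) (hk : 4 ≤ k)
    (h : ∀ z, deriv (deriv f) z + c * deriv f z ^ 2
      + ∑ n ∈ Finset.range (k + 1), a n * f z ^ n = 0) :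
    ∃ C, ∀ z, f z = C := by
  set P : Polynomial ℂ := ∑ n ∈ Finset.range (k + 1), Polynomial.monomial n (a n) with hP
  have hcoeff : P.coeff k = a k := by
    simp [hP, Polynomial.coeff_monomial]
  have heval : ∀ y, P.eval y = ∑ n ∈ Finset.range (k + 1), a n * y ^ n := by
    intro y
    simp [hP, Polynomial.eval_finsetSum]
  have hdeg : ((Polynomial.X : Polynomial ℂ) ^ 4).degree ≤ P.degree := by
    rw [Polynomial.degree_X_pow]
    refine le_trans ?_ (Polynomial.le_degree_of_ne_zero (hcoeff ▸ hak))
    exact_mod_cast hk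
  obtain ⟨K, hK, hO⟩ := (Polynomial.isBigO_cobounded_of_degree_le hdeg).exists_nonneg
  have hO' := hO.bound
  rw [← comap_norm_atTop, Filter.eventually_comap, Filter.eventually_atTop] at hO'
  obtain ⟨R, hR⟩ := hO'
  refine exists_const_of_pow_four_le hf (c := c) (R := R) hK fun z hz => ?_
  have h1 := hR _ hz (f z) rfl
  rw [heval] at h1
  rw [eq_neg_of_add_eq_zero_left (h z), norm_neg]
  simpa using h1


/-- Let `P(X) = a 0 + ⋯ + a k • X^k` with `a k ≠ 0`.  If
`w'' + c (w')² + P(w) = 0` admits a nonconstant meromorphic solution on `ℂ`, then `k ≤ 4`;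
moreover if `c = 0` then `k ≤ 3`. -/
theorem hayman_type2_degree_bound (c : ℂ) (k : ℕ) (a : ℕ → ℂ) (hak : a k ≠ 0) (w : ℂ → ℂ)
    (hmero : MeromorphicOn w Set.univ)
    (heq : ∀ z : ℂ, AnalyticAt ℂ w z →
      deriv (deriv w) z + c * (deriv w z) ^ 2
        + ∑ n ∈ Finset.range (k + 1), a n * (w z) ^ n = 0)
    (hnonconst : ¬ ∃ C : ℂ, ∀ z : ℂ, AnalyticAt ℂ w z → w z = C) :
    k ≤ 4 ∧ (c = 0 → k ≤ 3) := by
  by_contra hcon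
  have hk4 : 4 ≤ k := by
    by_contra hk
    exact hcon ⟨by omega, fun _ => by omega⟩
  have hck : c = 0 ∨ 5 ≤ k := by
    by_contra! hk
    exact hcon ⟨by omega, fun h => absurd h hk.1⟩
  have hev : ∀ x, ∀ᶠ z in nhdsWithin x {x}ᶜ, AnalyticAt ℂ w z := fun x =>
    (hmero x (Set.mem_univ x)).eventually_analyticAt
  by_cases hord : ∀ x, 0 ≤ meromorphicOrderAt w x
  · set g := toMeromorphicNFOn w Set.univ with hg
    have hga : ∀ x, AnalyticAt ℂ g x := fun x => by
      rw [← (meromorphicNFOn_toMeromorphicNFOn w Set.univ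
        (Set.mem_univ x)).meromorphicOrderAt_nonneg_iff_analyticAt,
        meromorphicOrderAt_toMeromorphicNFOn hmero (Set.mem_univ x)]
      exact hord x
    have hgw : ∀ x, AnalyticAt ℂ w x → g =ᶠ[nhds x] w := fun x hx =>
      ((hga x).continuousAt.eventuallyEq_nhds_iff_eventuallyEq_nhdsNE hx.continuousAt).mp
        (hmero.toMeromorphicNFOn_eq_self_on_nhdsNE (Set.mem_univ x))
    have hgeq : ∀ x, deriv (deriv g) x + c * deriv g x ^ 2
        + ∑ n ∈ Finset.range (k + 1), a n * g x ^ n = 0 := by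
      intro x
      have h0 := (hga x).continuousAt
      have h1 := (hga x).deriv.continuousAt
      have h2 := (hga x).deriv.deriv.continuousAt
      have hc : ContinuousAt (fun z => deriv (deriv g) z + c * deriv g z ^ 2
        + ∑ n ∈ Finset.range (k + 1), a n * g z ^ n) x := by fun_prop
      have hlim := hc.tendsto.mono_left (nhdsWithin_le_nhds (s := {x}ᶜ))
      refine tendsto_nhds_unique hlim (tendsto_const_nhds.congr' ?_)
      filter_upwards [hev x] with z hz
      have e := hgw z hz
      rw [e.deriv.deriv_eq, e.deriv_eq, e.eq_of_nhds, heq z hz]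
    have hgd : Differentiable ℂ g := fun x => (hga x).differentiableAt
    obtain ⟨C, hC⟩ := exists_const_of_deriv_deriv_add_eq_zero hgd hak hk4 hgeq
    exact hnonconst ⟨C, fun z hz => (hgw z hz).eq_of_nhds.symm.trans (hC z)⟩
  · push Not at hord
    obtain ⟨x, hx⟩ := hord
    obtain ⟨m, hm⟩ := WithTop.ne_top_iff_exists.mp hx.ne_top
    rw [← hm] at hx
    have hm0 : m < 0 := by exact_mod_cast hx
    obtain ⟨h, hh, hhx, hw⟩ := (meromorphicOrderAt_eq_int_iff (hmero x (Set.mem_univ x))).mp hm.symm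
    obtain ⟨p, rfl⟩ : ∃ p : ℕ, m = -(p : ℤ) := ⟨m.natAbs, by omega⟩
    have hp : 0 < p := by omega
    have hkp : 4 * p ≤ k * p := Nat.mul_le_mul_right p hk4
    refine not_pole_of_dominant_degree (c := c) (e := k * p - (p + 3)) hak hh hhx hp
      (by simpa using hw) ((hev x).mono fun z hz => heq z hz) (by omega) ?_
    refine hck.imp_right fun hk5 => ⟨k * p - (2 * p + 3), ?_⟩
    have : 5 * p ≤ k * p := Nat.mul_le_mul_right p hk5
    omega
end

section
/- Let P(X) = a_0 + a_1 X + ... + a_k X^k be a polynomial with complex constant coefficients, a_k ≠ 0, and k = 2 or k = 3. Then every entire function w : ℂ → ℂ satisfying w''(z) + P(w(z)) = 0 for all z ∈ ℂ is constant. -/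
/-- A polynomial function of degree `k ≥ 2` grows at least quadratically. -/
lemma exists_mul_sq_norm_le_norm_sum_mul_pow (k : ℕ) (hk : 2 ≤ k) (a : ℕ → ℂ) (hak : a k ≠ 0) :
    ∃ c M : ℝ, 0 < c ∧ ∀ x : ℂ, M ≤ ‖x‖ →
      c * ‖x‖ ^ 2 ≤ ‖∑ n ∈ Finset.range (k + 1), a n * x ^ n‖ := by
  have ha : 0 < ‖a k‖ := norm_pos_iff.2 hak
  set S := ∑ n ∈ Finset.range k, ‖a n‖ with hS
  refine ⟨‖a k‖ / 2, max 1 (2 * S / ‖a k‖), by positivity, fun x hx => ?_⟩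
  have h1 : 1 ≤ ‖x‖ := (le_max_left _ _).trans hx
  have h2 : 2 * S ≤ ‖x‖ * ‖a k‖ := (div_le_iff₀ ha).1 ((le_max_right _ _).trans hx)
  have hlow : ‖∑ n ∈ Finset.range k, a n * x ^ n‖ ≤ S * ‖x‖ ^ (k - 1) := by
    rw [hS, Finset.sum_mul]
    refine norm_sum_le_of_le _ fun n hn => ?_
    rw [norm_mul, norm_pow]
    gcongr
    have := Finset.mem_range.1 hn
    omega
  have hpow : ‖x‖ ^ k = ‖x‖ ^ (k - 1) * ‖x‖ := by
    rw [← pow_succ, Nat.sub_add_cancel (by omega)]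
  have hle : S * ‖x‖ ^ (k - 1) ≤ ‖a k‖ / 2 * ‖x‖ ^ k := by
    rw [hpow]
    nlinarith [pow_nonneg (norm_nonneg x) (k - 1)]
  have hsq : ‖a k‖ / 2 * ‖x‖ ^ 2 ≤ ‖a k‖ / 2 * ‖x‖ ^ k := by
    gcongr
  have htri := norm_sub_le_norm_add (a k * x ^ k) (∑ n ∈ Finset.range k, a n * x ^ n)
  rw [Finset.sum_range_succ, add_comm]
  rw [norm_mul, norm_pow] at htri
  linarith

/-- An entire function whose second derivative dominates the square of the function wherever
the function is large is bounded. -/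
lemma exists_forall_norm_le_of_mul_sq_le_norm_deriv_deriv {w : ℂ → ℂ} (hw : Differentiable ℂ w)
    {c M : ℝ} (hc : 0 < c) (h : ∀ z, M ≤ ‖w z‖ → c * ‖w z‖ ^ 2 ≤ ‖deriv (deriv w) z‖) :
    ∃ B : ℝ, ∀ z, ‖w z‖ ≤ B := by
  by_contra! hunb
  obtain ⟨z₀, hz₀⟩ := hunb (max M (8 / c))
  set A := ‖w z₀‖
  have hAM : M ≤ A := (le_max_left _ _).trans hz₀.le
  have hA8 : 8 < A * c := (div_lt_iff₀ hc).1 ((le_max_right _ _).trans_lt hz₀)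
  have hA : 0 < A := ((by positivity : 0 < 8 / c).trans_le (le_max_right _ _)).trans hz₀
  have step : ∀ (n : ℕ) (z : ℂ), 4 ^ n * A ≤ ‖w z‖ →
      ∃ z', dist z z' ≤ 1 * (1 / 2 : ℝ) ^ n ∧ 4 ^ (n + 1) * A ≤ ‖w z'‖ := by
    intro n z hz
    by_contra! hcon
    have hr : (0 : ℝ) < (1 / 2) ^ n := by positivity
    have hcauchy := Complex.norm_iteratedDeriv_le_of_forall_mem_sphere_norm_le 2 hr
      hw.diffContOnCl (C := 4 ^ (n + 1) * A) (c := z) fun y hy =>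
        (hcon y (by rw [dist_comm, Metric.mem_sphere.1 hy, one_mul])).le
    have h1 : (1 : ℝ) ≤ 4 ^ n := one_le_pow₀ (by norm_num)
    have hlow := h z (by nlinarith)
    rw [iteratedDeriv_succ, iteratedDeriv_one] at hcauchy
    have hexp : ((2 : ℕ).factorial : ℝ) * (4 ^ (n + 1) * A) / ((1 / 2 : ℝ) ^ n) ^ 2
        = 8 * (4 ^ n) ^ 2 * A := by
      have : ((1 / 2 : ℝ) ^ n) ^ 2 = 1 / 4 ^ n := by
        rw [← pow_mul, mul_comm, pow_mul, ← one_div_pow]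
        norm_num
      rw [this, pow_succ]
      simp only [Nat.factorial_two, Nat.cast_ofNat]
      field_simp
      ring
    have hsq : c * (4 ^ n * A) ^ 2 ≤ c * ‖w z‖ ^ 2 := by gcongr
    have hpos : 0 < (4 ^ n : ℝ) ^ 2 * A := by positivity
    nlinarith
  choose! f hfd hfw using step
  let u : ℕ → ℂ := fun n => Nat.rec z₀ (fun n z => f n z) n
  have hu : ∀ n, 4 ^ n * A ≤ ‖w (u n)‖ := by
    intro n
    induction n with
    | zero => simp [u, A]
    | succ n ih => exact hfw n (u n) ih
  have hcs : CauchySeq u :=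
    cauchySeq_of_le_geometric (1 / 2) 1 (by norm_num) fun n => hfd n (u n) (hu n)
  obtain ⟨l, hl⟩ := cauchySeq_tendsto_of_complete hcs
  have hlim := ((hw.continuous.tendsto l).comp hl).norm
  have htop : Filter.Tendsto (fun n => ‖w (u n)‖) Filter.atTop Filter.atTop :=
    Filter.tendsto_atTop_mono hu
      ((tendsto_pow_atTop_atTop_of_one_lt (by norm_num)).atTop_mul_const hA)
  exact not_tendsto_nhds_of_tendsto_atTop htop _ hlim

/-- Let `P(X) = a 0 + ⋯ + a k • X^k` with `a k ≠ 0` and `k = 2` or `k = 3`.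
Then every entire function `w` satisfying `w'' + P(w) = 0` on all of `ℂ` is constant. -/
theorem hayman_type2_entire_constant (k : ℕ) (a : ℕ → ℂ) (hak : a k ≠ 0)
    (hk : k = 2 ∨ k = 3) (w : ℂ → ℂ) (hentire : Differentiable ℂ w)
    (heq : ∀ z : ℂ,
      deriv (deriv w) z + ∑ n ∈ Finset.range (k + 1), a n * (w z) ^ n = 0) :
    ∃ c : ℂ, ∀ z : ℂ, w z = c := by
  obtain ⟨c, M, hc, hP⟩ := exists_mul_sq_norm_le_norm_sum_mul_pow k (by omega) a hak
  obtain ⟨B, hB⟩ := exists_forall_norm_le_of_mul_sq_le_norm_deriv_deriv hentire hc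
    (M := M) fun z hz => by
      rw [eq_neg_of_add_eq_zero_left (heq z), norm_neg]
      exact hP (w z) hz
  refine hentire.exists_const_forall_eq_of_bounded ?_
  exact isBounded_iff_forall_norm_le.2 ⟨B, Set.forall_mem_range.2 hB⟩
end

section
/- Let λ ∈ ℂ \ {0}, c, e_1, e_2 ∈ ℂ. If the differential equation w'' + c·w' − (6/λ)(w − e_1)(w − e_2) = 0 admits a nonconstant meromorphic solution on ℂ, then c·(c²λ + 25(e_1 − e_2))·(c²λ − 25(e_1 − e_2)) = 0. -/
open Filter Topology

/-- A Taylor step: an analytic function, together with its first two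
derivatives, written in terms of its value at `z₀` and the difference quotient at `z₀`. -/
theorem AnalyticAt.exists_eq_add_sub_mul {g : ℂ → ℂ} {z₀ : ℂ} (hg : AnalyticAt ℂ g z₀) :
    ∃ (a : ℂ) (h : ℂ → ℂ), AnalyticAt ℂ h z₀ ∧ ∀ᶠ z in 𝓝 z₀,
      g z = a + (z - z₀) * h z ∧
      deriv g z = h z + (z - z₀) * deriv h z ∧
      deriv (deriv g) z = 2 * deriv h z + (z - z₀) * deriv (deriv h) z := by
  obtain ⟨p, hp⟩ := hg
  have hh : AnalyticAt ℂ (dslope g z₀) z₀ := ⟨_, hp.has_fpower_series_dslope_fslope⟩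
  refine ⟨g z₀, dslope g z₀, hh, ?_⟩
  have hgeq : g = fun z => g z₀ + (z - z₀) * dslope g z₀ z := by
    funext z
    have := sub_smul_dslope g z₀ z
    simp only [smul_eq_mul] at this
    rw [this]; ring
  have h1 : ∀ᶠ z in 𝓝 z₀, deriv g z = dslope g z₀ z + (z - z₀) * deriv (dslope g z₀) z := by
    filter_upwards [hh.eventually_analyticAt] with z hz
    have := (((hasDerivAt_id z).sub_const z₀).mul hz.differentiableAt.hasDerivAt).const_add (g z₀)
    conv_lhs => rw [hgeq]
    refine (this.deriv.trans ?_)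
    simp
  have h2 : ∀ᶠ z in 𝓝 z₀, deriv (deriv g) z =
      2 * deriv (dslope g z₀) z + (z - z₀) * deriv (deriv (dslope g z₀)) z := by
    filter_upwards [h1.eventually_nhds, hh.eventually_analyticAt] with z hz hza
    rw [Filter.EventuallyEq.deriv_eq hz]
    have := hza.differentiableAt.hasDerivAt.add
      (((hasDerivAt_id z).sub_const z₀).mul hza.deriv.differentiableAt.hasDerivAt)
    refine (this.deriv.trans ?_)
    simp only [id]
    ring
  filter_upwards [h1, h2] with z e1 e2
  exact ⟨congrFun hgeq z, e1, e2⟩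

theorem eq_zero_of_add_sub_mul_eq_zero {z₀ E : ℂ} {K : ℂ → ℂ} (hK : ContinuousAt K z₀)
    (h : ∀ᶠ z in 𝓝[≠] z₀, E + (z - z₀) * K z = 0) :
    E = 0 ∧ ∀ᶠ z in 𝓝[≠] z₀, K z = 0 := by
  have h0 : (fun z => E + (z - z₀) * K z) =ᶠ[𝓝 z₀] fun _ => 0 :=
    (ContinuousAt.eventuallyEq_nhds_iff_eventuallyEq_nhdsNE (by fun_prop) (by fun_prop)).1 h
  have hE : E = 0 := by simpa using h0.eq_of_nhds
  refine ⟨hE, ?_⟩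
  filter_upwards [h, self_mem_nhdsWithin] with z hz hne
  rw [hE, zero_add] at hz
  exact (mul_eq_zero.1 hz).resolve_left (sub_ne_zero.2 hne)

theorem deriv_eventuallyEq_zpow_mul {v g : ℂ → ℂ} {z₀ : ℂ} {n : ℤ} (hg : AnalyticAt ℂ g z₀)
    (hv : ∀ᶠ z in 𝓝[≠] z₀, v z = (z - z₀) ^ n * g z) :
    ∀ᶠ z in 𝓝[≠] z₀, deriv v z = (z - z₀) ^ (n - 1) * (n * g z + (z - z₀) * deriv g z) := by
  filter_upwards [Filter.EventuallyEq.nhdsNE_deriv hv, self_mem_nhdsWithin,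
    hg.eventually_analyticAt.filter_mono nhdsWithin_le_nhds] with z hz hne hga
  rw [hz]
  have hx : z - z₀ ≠ 0 := sub_ne_zero.2 hne
  have h1 : HasDerivAt (fun z => (z - z₀) ^ n) (n * (z - z₀) ^ (n - 1)) z :=
    (hasDerivAt_zpow n (z - z₀) (Or.inl hx)).comp_sub_const z z₀
  refine (h1.mul hga.differentiableAt.hasDerivAt).deriv.trans ?_
  have : (z - z₀) ^ n = (z - z₀) ^ (n - 1) * (z - z₀) := by
    rw [← zpow_add_one₀ hx]; simp
  rw [this]
  ring

/-- The recursion for the Laurent coefficients at a double pole of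
`v'' + c v' = 6 (v - f₁) (v - f₂)` is solvable up to the resonance only under a condition. -/
theorem laurent_coeff_resonance {c f₁ f₂ a₁ a₂ a₃ a₄ a₅ a₆ : ℂ}
    (h1 : 2 * a₁ - 2 * c = 12 * a₁)
    (h2 : -c * a₁ = 6 * (2 * a₂ + a₁ ^ 2 - (f₁ + f₂)))
    (h3 : 0 = 6 * (2 * a₃ + 2 * a₁ * a₂ - (f₁ + f₂) * a₁))
    (h4 : 2 * a₄ + c * a₃ = 6 * (2 * a₄ + 2 * a₁ * a₃ + a₂ ^ 2 - (f₁ + f₂) * a₂ + f₁ * f₂))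
    (h5 : 6 * a₅ + 2 * c * a₄ = 6 * (2 * a₅ + 2 * a₁ * a₄ + 2 * a₂ * a₃ - (f₁ + f₂) * a₃))
    (h6 : 12 * a₆ + 3 * c * a₅ =
      6 * (2 * a₆ + 2 * a₁ * a₅ + 2 * a₂ * a₄ + a₃ ^ 2 - (f₁ + f₂) * a₄)) :
    c * (c ^ 2 + 25 * (f₁ - f₂)) * (c ^ 2 - 25 * (f₁ - f₂)) = 0 := by
  obtain rfl : a₁ = -c / 5 := by linear_combination (-1 / 10) * h1
  obtain rfl : a₂ = (f₁ + f₂) / 2 - c ^ 2 / 300 := by linear_combination (-1 / 12) * h2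
  obtain rfl : a₃ = -c ^ 3 / 1500 := by linear_combination (-1 / 12) * h3
  obtain rfl : a₄ = -(1 / 10) * (6 * (2 * (-c / 5) * (-c ^ 3 / 1500) +
      ((f₁ + f₂) / 2 - c ^ 2 / 300) ^ 2 - (f₁ + f₂) * ((f₁ + f₂) / 2 - c ^ 2 / 300) + f₁ * f₂) -
      c * (-c ^ 3 / 1500)) := by linear_combination (-1 / 10) * h4
  have key : c * (c * (c ^ 2 + 25 * (f₁ - f₂)) * (c ^ 2 - 25 * (f₁ - f₂))) = 0 := by
    linear_combination (-3125 / 3) * h6 - (3125 / 3) * (9 / 10) * c * h5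
  rcases mul_eq_zero.1 key with h | h
  · simp [h]
  · exact h

/-- The regular part `g` of a solution at a double pole satisfies a Fuchsian equation whose
resonance forces the condition on the parameters. -/
theorem condition_of_double_pole {c f₁ f₂ z₀ : ℂ} {g : ℂ → ℂ} (hg : AnalyticAt ℂ g z₀)
    (hg0 : g z₀ = 1)
    (h : ∀ᶠ z in 𝓝[≠] z₀, (z - z₀) ^ 2 * deriv (deriv g) z - 4 * (z - z₀) * deriv g z + 6 * g z
      + c * ((z - z₀) ^ 2 * deriv g z - 2 * (z - z₀) * g z)
      = 6 * (g z - f₁ * (z - z₀) ^ 2) * (g z - f₂ * (z - z₀) ^ 2)) :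
    c * (c ^ 2 + 25 * (f₁ - f₂)) * (c ^ 2 - 25 * (f₁ - f₂)) = 0 := by
  obtain ⟨a₀, g₁, hg₁, e₀⟩ := hg.exists_eq_add_sub_mul
  obtain ⟨a₁, g₂, hg₂, e₁⟩ := hg₁.exists_eq_add_sub_mul
  obtain ⟨a₂, g₃, hg₃, e₂⟩ := hg₂.exists_eq_add_sub_mul
  obtain ⟨a₃, g₄, hg₄, e₃⟩ := hg₃.exists_eq_add_sub_mul
  obtain ⟨a₄, g₅, hg₅, e₄⟩ := hg₄.exists_eq_add_sub_mul
  obtain ⟨a₅, g₆, hg₆, e₅⟩ := hg₅.exists_eq_add_sub_mul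
  obtain ⟨a₆, r, hr, e₆⟩ := hg₆.exists_eq_add_sub_mul
  obtain rfl : a₀ = 1 := by
    have := e₀.self_of_nhds.1
    rw [hg0] at this
    simpa using this.symm
  have hc0 : ContinuousAt r z₀ := hr.continuousAt
  have hc1 : ContinuousAt (deriv r) z₀ := hr.deriv.continuousAt
  have hc2 : ContinuousAt (deriv (deriv r)) z₀ := hr.deriv.deriv.continuousAt
  let s := f₁ + f₂
  let H : ℂ → ℂ := fun z =>
    42 * r z + 14 * (z - z₀) * deriv r z + (z - z₀) ^ 2 * deriv (deriv r) z
    - 4 * (7 * r z + (z - z₀) * deriv r z) + 6 * r z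
    + c * (7 * (z - z₀) * r z + (z - z₀) ^ 2 * deriv r z) - 2 * c * (z - z₀) * r z
    + 4 * c * a₆
    - 6 * (2 * (1 + a₁ * (z - z₀) + a₂ * (z - z₀) ^ 2 + a₃ * (z - z₀) ^ 3 + a₄ * (z - z₀) ^ 4
      + a₅ * (z - z₀) ^ 5 + a₆ * (z - z₀) ^ 6) * r z + (z - z₀) ^ 7 * r z ^ 2
      - s * (z - z₀) ^ 2 * r z - s * a₅ - s * a₆ * (z - z₀))
    - 6 * (2 * (a₁ * a₆ + a₂ * a₅ + a₃ * a₄) + (z - z₀) * (2 * a₂ * a₆ + 2 * a₃ * a₅ + a₄ ^ 2)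
      + (z - z₀) ^ 2 * (2 * a₃ * a₆ + 2 * a₄ * a₅) + (z - z₀) ^ 3 * (2 * a₄ * a₆ + a₅ ^ 2)
      + (z - z₀) ^ 4 * (2 * a₅ * a₆) + (z - z₀) ^ 5 * a₆ ^ 2)
  have hH : ContinuousAt H z₀ := by fun_prop
  let E₁ := 2 * a₁ - 2 * c - 12 * a₁
  let E₂ := -c * a₁ - 6 * (2 * a₂ + a₁ ^ 2 - s)
  let E₃ := 0 - 6 * (2 * a₃ + 2 * a₁ * a₂ - s * a₁)
  let E₄ := 2 * a₄ + c * a₃ - 6 * (2 * a₄ + 2 * a₁ * a₃ + a₂ ^ 2 - s * a₂ + f₁ * f₂)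
  let E₅ := 6 * a₅ + 2 * c * a₄ - 6 * (2 * a₅ + 2 * a₁ * a₄ + 2 * a₂ * a₃ - s * a₃)
  let E₆ := 12 * a₆ + 3 * c * a₅ -
    6 * (2 * a₆ + 2 * a₁ * a₅ + 2 * a₂ * a₄ + a₃ ^ 2 - s * a₄)
  have hexp : ∀ᶠ z in 𝓝[≠] z₀, 0 + (z - z₀) * (E₁ + (z - z₀) * (E₂ + (z - z₀) * (E₃ +
      (z - z₀) * (E₄ + (z - z₀) * (E₅ + (z - z₀) * (E₆ + (z - z₀) * H z)))))) = 0 := by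
    filter_upwards [h, e₀.filter_mono nhdsWithin_le_nhds, e₁.filter_mono nhdsWithin_le_nhds,
      e₂.filter_mono nhdsWithin_le_nhds, e₃.filter_mono nhdsWithin_le_nhds,
      e₄.filter_mono nhdsWithin_le_nhds, e₅.filter_mono nhdsWithin_le_nhds,
      e₆.filter_mono nhdsWithin_le_nhds] with z h e₀ e₁ e₂ e₃ e₄ e₅ e₆
    rw [e₀.1, e₀.2.1, e₀.2.2, e₁.1, e₁.2.1, e₁.2.2, e₂.1, e₂.2.1, e₂.2.2, e₃.1, e₃.2.1, e₃.2.2,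
      e₄.1, e₄.2.1, e₄.2.2, e₅.1, e₅.2.1, e₅.2.2, e₆.1, e₆.2.1, e₆.2.2] at h
    simp only [E₁, E₂, E₃, E₄, E₅, E₆, H, s]
    generalize z - z₀ = x at h ⊢
    linear_combination h
  obtain ⟨-, hexp⟩ := eq_zero_of_add_sub_mul_eq_zero (by fun_prop) hexp
  obtain ⟨h1, hexp⟩ := eq_zero_of_add_sub_mul_eq_zero (by fun_prop) hexp
  obtain ⟨h2, hexp⟩ := eq_zero_of_add_sub_mul_eq_zero (by fun_prop) hexp
  obtain ⟨h3, hexp⟩ := eq_zero_of_add_sub_mul_eq_zero (by fun_prop) hexp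
  obtain ⟨h4, hexp⟩ := eq_zero_of_add_sub_mul_eq_zero (by fun_prop) hexp
  obtain ⟨h5, hexp⟩ := eq_zero_of_add_sub_mul_eq_zero (by fun_prop) hexp
  obtain ⟨h6, -⟩ := eq_zero_of_add_sub_mul_eq_zero hH hexp
  exact laurent_coeff_resonance (sub_eq_zero.1 h1) (sub_eq_zero.1 h2) (sub_eq_zero.1 h3)
    (sub_eq_zero.1 h4) (sub_eq_zero.1 h5) (sub_eq_zero.1 h6)

/-- A solution of `v'' + c v' = 6 (v - f₁) (v - f₂)` with a pole forces the condition. -/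
theorem condition_of_pole {c f₁ f₂ z₀ : ℂ} {v g : ℂ → ℂ} {k : ℕ} (hk : 0 < k)
    (hg : AnalyticAt ℂ g z₀) (hg0 : g z₀ ≠ 0)
    (hv : ∀ᶠ z in 𝓝[≠] z₀, v z = (z - z₀) ^ (-(k : ℤ)) * g z)
    (hode : ∀ᶠ z in 𝓝[≠] z₀,
      deriv (deriv v) z + c * deriv v z = 6 * (v z - f₁) * (v z - f₂)) :
    c * (c ^ 2 + 25 * (f₁ - f₂)) * (c ^ 2 - 25 * (f₁ - f₂)) = 0 := by
  let G₁ : ℂ → ℂ := fun z => ((-(k : ℤ) : ℤ) : ℂ) * g z + (z - z₀) * deriv g z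
  have hdg : AnalyticAt ℂ (deriv g) z₀ := hg.deriv
  have hddg : AnalyticAt ℂ (deriv (deriv g)) z₀ := hdg.deriv
  have hG₁ : AnalyticAt ℂ G₁ z₀ := by fun_prop
  have hv1 := deriv_eventuallyEq_zpow_mul hg hv
  have hv2 := deriv_eventuallyEq_zpow_mul hG₁ hv1
  have hdG : ∀ᶠ z in 𝓝 z₀, deriv G₁ z
      = ((-(k : ℤ) : ℤ) : ℂ) * deriv g z + (deriv g z + (z - z₀) * deriv (deriv g) z) := by
    filter_upwards [hg.eventually_analyticAt] with z hz
    refine ((hz.differentiableAt.hasDerivAt.const_mul _).add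
      (((hasDerivAt_id z).sub_const z₀).mul hz.deriv.differentiableAt.hasDerivAt)).deriv.trans ?_
    simp
  let L : ℂ → ℂ := fun z => (k + 1) * (k * g z - (z - z₀) * deriv g z)
    + (z - z₀) * (-k * deriv g z + deriv g z + (z - z₀) * deriv (deriv g) z)
    + c * ((z - z₀) * (-k * g z + (z - z₀) * deriv g z))
  have hgc := hg.continuousAt
  have hdgc := hdg.continuousAt
  have hddgc := hddg.continuousAt
  have hL : ContinuousAt L z₀ := by fun_prop
  have main : ∀ᶠ z in 𝓝[≠] z₀, (z - z₀) ^ k * L z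
      = 6 * (z - z₀) ^ 2 * (g z - f₁ * (z - z₀) ^ k) * (g z - f₂ * (z - z₀) ^ k) := by
    filter_upwards [hode, hv, hv1, hv2, hdG.filter_mono nhdsWithin_le_nhds, self_mem_nhdsWithin]
      with z e e0 e1 e2 eG hne
    have hx : z - z₀ ≠ 0 := sub_ne_zero.2 hne
    rw [e2, e1, e0, eG] at e
    simp only [G₁] at e
    simp only [L]
    rw [show -(k : ℤ) - 1 - 1 = -((k + 2 : ℕ) : ℤ) by push_cast; ring,
      show -(k : ℤ) - 1 = -((k + 1 : ℕ) : ℤ) by push_cast; ring] at e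
    simp only [zpow_neg, zpow_natCast] at e
    push_cast at e
    generalize z - z₀ = x at *
    have hxk : x ^ k ≠ 0 := pow_ne_zero _ hx
    simp only [pow_add] at e
    field_simp at e
    linear_combination e
  obtain rfl | hk2 : k = 1 ∨ 2 ≤ k := by omega
  · exfalso
    have : ∀ᶠ z in 𝓝[≠] z₀, L z
        = 6 * (z - z₀) * (g z - f₁ * (z - z₀)) * (g z - f₂ * (z - z₀)) := by
      filter_upwards [main, self_mem_nhdsWithin] with z e hne
      have hx : z - z₀ ≠ 0 := sub_ne_zero.2 hne
      apply mul_left_cancel₀ hx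
      linear_combination e
    have h0 := ((ContinuousAt.eventuallyEq_nhds_iff_eventuallyEq_nhdsNE hL
      (by fun_prop)).1 this).eq_of_nhds
    simp [L] at h0
    exact hg0 h0
  · obtain ⟨m, rfl⟩ := Nat.exists_eq_add_of_le' hk2
    have main' : ∀ᶠ z in 𝓝[≠] z₀, (z - z₀) ^ m * L z
        = 6 * (g z - f₁ * (z - z₀) ^ (m + 2)) * (g z - f₂ * (z - z₀) ^ (m + 2)) := by
      filter_upwards [main, self_mem_nhdsWithin] with z e hne
      have hx : z - z₀ ≠ 0 := sub_ne_zero.2 hne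
      apply mul_left_cancel₀ (pow_ne_zero 2 hx)
      linear_combination e
    have h0 := ((ContinuousAt.eventuallyEq_nhds_iff_eventuallyEq_nhdsNE (by fun_prop)
      (by fun_prop)).1 main').eq_of_nhds
    rcases Nat.eq_zero_or_pos m with rfl | hm
    · have hg1 : g z₀ = 1 := by
        simp [L] at h0
        have : g z₀ * (g z₀ - 1) = 0 := by linear_combination (-1 / 6) * h0
        exact sub_eq_zero.1 ((mul_eq_zero.1 this).resolve_left hg0)
      refine condition_of_double_pole hg hg1 ?_
      filter_upwards [main'] with z e
      simp only [L] at e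
      push_cast at e
      linear_combination e
    · simp [L, hm.ne', hg0] at h0

/-- A continuous function whose square is controlled by its maximum on slightly larger discs, with
a loss inverse quadratic in the increase of the radius, is bounded. -/
theorem bounded_of_sq_le {v : ℂ → ℂ} (hv : Continuous v) {K : ℝ} (hK : 0 ≤ K)
    (h : ∀ (z : ℂ) (δ M : ℝ), 0 < δ → δ ≤ 1 → 1 ≤ M → (∀ ζ ∈ Metric.closedBall z δ, ‖v ζ‖ ≤ M) →
      ‖v z‖ ^ 2 ≤ K * M / δ ^ 2) (z : ℂ) : ‖v z‖ ≤ 16 * K + 1 := by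
  by_contra! hz
  have key : ∀ n : ℕ, ∃ ζ, dist ζ z ≤ 1 - (1 / 2) ^ n ∧ (16 * K + 1) * 4 ^ n < ‖v ζ‖ := by
    intro n
    induction n with
    | zero => exact ⟨z, by simp, by simpa using hz⟩
    | succ n ih =>
      obtain ⟨ζ, hd, hζ⟩ := ih
      by_contra! hcon
      have h4 : (1 : ℝ) ≤ 4 ^ n := one_le_pow₀ (by norm_num)
      have hb := h ζ ((1 / 2) ^ (n + 1)) ((16 * K + 1) * 4 ^ (n + 1)) (by positivity)
        (pow_le_one₀ (by norm_num) (by norm_num)) (by rw [pow_succ]; nlinarith) (by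
          intro ξ hξ
          apply hcon
          have := dist_triangle ξ ζ z
          rw [Metric.mem_closedBall] at hξ
          rw [pow_succ] at hξ ⊢
          linarith)
      have he : K * ((16 * K + 1) * 4 ^ (n + 1)) / ((1 / 2 : ℝ) ^ (n + 1)) ^ 2
          = 16 * K * (16 * K + 1) * (4 ^ n) ^ 2 := by
        have : ((1 / 2 : ℝ) ^ (n + 1)) ^ 2 = (4 ^ (n + 1))⁻¹ := by
          rw [← pow_mul, mul_comm (n + 1) 2, pow_mul, ← inv_pow]
          norm_num
        rw [this, div_inv_eq_mul]
        ring
      rw [he] at hb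
      have hsq : ((16 * K + 1) * 4 ^ n) ^ 2 < ‖v ζ‖ ^ 2 :=
        pow_lt_pow_left₀ hζ (by positivity) (by norm_num)
      have : 0 < (16 * K + 1) * (4 ^ n) ^ 2 := by positivity
      nlinarith
  obtain ⟨B, hB⟩ := (isCompact_closedBall z 1).exists_bound_of_continuousOn hv.continuousOn
  obtain ⟨n, hn⟩ := pow_unbounded_of_one_lt B (by norm_num : (1 : ℝ) < 4)
  obtain ⟨ζ, hd, hζ⟩ := key n
  have h1 := hB ζ (by
    rw [Metric.mem_closedBall]
    have : (0 : ℝ) ≤ (1 / 2) ^ n := by positivity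
    linarith)
  have : (0 : ℝ) < 4 ^ n := by positivity
  nlinarith

/-- Entire solutions of `v'' + c v' = 6 (v - f₁) (v - f₂)` are constant. -/
theorem entire_solution_const {c f₁ f₂ : ℂ} {v : ℂ → ℂ} (hv : Differentiable ℂ v)
    (hode : ∀ z, deriv (deriv v) z + c * deriv v z = 6 * (v z - f₁) * (v z - f₂)) (z z' : ℂ) :
    v z = v z' := by
  let K : ℝ := 2 + ‖c‖ + 6 * ‖f₁ + f₂‖ + 6 * ‖f₁ * f₂‖
  have hK : 0 ≤ K := by positivity
  refine hv.apply_eq_apply_of_bounded (isBounded_iff_forall_norm_le.2 ⟨16 * K + 1, ?_⟩) z z'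
  rintro _ ⟨z, rfl⟩
  refine bounded_of_sq_le hv.continuous hK (fun z δ M hδ hδ1 hM hb => ?_) z
  have hs : ∀ ζ ∈ Metric.sphere z δ, ‖v ζ‖ ≤ M :=
    fun ζ hζ => hb ζ (Metric.sphere_subset_closedBall hζ)
  have h1 : ‖deriv v z‖ ≤ M / δ :=
    Complex.norm_deriv_le_of_forall_mem_sphere_norm_le hδ hv.diffContOnCl hs
  have h2 : ‖deriv (deriv v) z‖ ≤ 2 * M / δ ^ 2 := by
    have := Complex.norm_iteratedDeriv_le_of_forall_mem_sphere_norm_le 2 hδ hv.diffContOnCl hs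
    simpa [iteratedDeriv_succ] using this
  have h0 : ‖v z‖ ≤ M := hb z (Metric.mem_closedBall_self hδ.le)
  have hδ2 : δ ^ 2 ≤ 1 := pow_le_one₀ hδ.le hδ1
  have hMδ : M / δ ≤ M / δ ^ 2 := by
    apply div_le_div_of_nonneg_left (by linarith) (by positivity)
    nlinarith
  have hMM : M ≤ M / δ ^ 2 := by
    rw [le_div_iff₀ (by positivity)]
    nlinarith
  have he : 6 * v z ^ 2 = deriv (deriv v) z + c * deriv v z + 6 * (f₁ + f₂) * v z
      - 6 * (f₁ * f₂) := by
    linear_combination (-1 : ℂ) * hode z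
  have hn : 6 * ‖v z‖ ^ 2 ≤ ‖deriv (deriv v) z‖ + ‖c‖ * ‖deriv v z‖ + 6 * ‖f₁ + f₂‖ * ‖v z‖
      + 6 * ‖f₁ * f₂‖ := by
    calc 6 * ‖v z‖ ^ 2 = ‖6 * v z ^ 2‖ := by simp
      _ ≤ _ := by
        rw [he]
        have h₃ := norm_add₃_le (a := deriv (deriv v) z) (b := c * deriv v z)
          (c := 6 * (f₁ + f₂) * v z)
        have h₄ := norm_sub_le (deriv (deriv v) z + c * deriv v z + 6 * (f₁ + f₂) * v z)
          (6 * (f₁ * f₂))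
        simp only [norm_mul, Complex.norm_ofNat] at h₃ h₄ ⊢
        linarith
  set Q := M / δ ^ 2 with hQ
  have t1 : ‖c‖ * ‖deriv v z‖ ≤ ‖c‖ * Q := by gcongr; linarith
  have t2 : 6 * ‖f₁ + f₂‖ * ‖v z‖ ≤ 6 * ‖f₁ + f₂‖ * Q := by gcongr; linarith
  have t3 : 6 * ‖f₁ * f₂‖ ≤ 6 * ‖f₁ * f₂‖ * Q :=
    le_mul_of_one_le_right (by positivity) (by linarith)
  have t4 : 2 * M / δ ^ 2 = 2 * Q := by rw [hQ]; ring
  have t5 : K * M / δ ^ 2 = K * Q := by rw [hQ]; ring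
  rw [t5]
  rw [t4] at h2
  simp only [K]
  nlinarith [sq_nonneg ‖v z‖]

/-- The necessary condition for the equation normalized to `v'' + c v' = 6 (v - f₁) (v - f₂)`. -/
theorem condition_of_normalized {c f₁ f₂ : ℂ} {v : ℂ → ℂ} (hmero : MeromorphicOn v Set.univ)
    (hode : ∀ z, AnalyticAt ℂ v z →
      deriv (deriv v) z + c * deriv v z = 6 * (v z - f₁) * (v z - f₂))
    (hnonconst : ¬ ∃ C : ℂ, ∀ z : ℂ, AnalyticAt ℂ v z → v z = C) :
    c * (c ^ 2 + 25 * (f₁ - f₂)) * (c ^ 2 - 25 * (f₁ - f₂)) = 0 := by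
  have hodeNE : ∀ z₀, ∀ᶠ z in 𝓝[≠] z₀,
      deriv (deriv v) z + c * deriv v z = 6 * (v z - f₁) * (v z - f₂) := fun z₀ => by
    filter_upwards [(hmero z₀ trivial).eventually_analyticAt] with z hz using hode z hz
  by_cases hpole : ∃ z₀, meromorphicOrderAt v z₀ < 0
  · obtain ⟨z₀, hz₀⟩ := hpole
    obtain ⟨n, hn⟩ := WithTop.ne_top_iff_exists.1 hz₀.ne_top
    rw [← hn] at hz₀
    have hn0 : n < 0 := by exact_mod_cast hz₀
    obtain ⟨g, hg, hg0, hvg⟩ := (meromorphicOrderAt_eq_int_iff (hmero z₀ trivial)).1 hn.symm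
    obtain ⟨k, rfl⟩ : ∃ k : ℕ, n = -(k : ℤ) := ⟨n.natAbs, by omega⟩
    exact condition_of_pole (by omega) hg hg0 hvg (hodeNE z₀)
  · push Not at hpole
    exfalso
    let V := toMeromorphicNFOn v Set.univ
    have hVv : ∀ z₀, V =ᶠ[𝓝[≠] z₀] v := fun z₀ =>
      hmero.toMeromorphicNFOn_eq_self_on_nhdsNE (Set.mem_univ z₀)
    have hV : ∀ z, AnalyticAt ℂ V z := fun z => by
      rw [← (meromorphicNFOn_toMeromorphicNFOn v Set.univ
        (Set.mem_univ z)).meromorphicOrderAt_nonneg_iff_analyticAt,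
        meromorphicOrderAt_congr (hVv z)]
      exact hpole z
    have hVode : ∀ z, deriv (deriv V) z + c * deriv V z = 6 * (V z - f₁) * (V z - f₂) := by
      intro z₀
      have hc0 := (hV z₀).continuousAt
      have hc1 := (hV z₀).deriv.continuousAt
      have hc2 := (hV z₀).deriv.deriv.continuousAt
      have : (fun z => deriv (deriv V) z + c * deriv V z) =ᶠ[𝓝[≠] z₀]
          fun z => 6 * (V z - f₁) * (V z - f₂) := by
        filter_upwards [hodeNE z₀, hVv z₀, (hVv z₀).nhdsNE_deriv, (hVv z₀).nhdsNE_deriv.nhdsNE_deriv]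
          with z e e0 e1 e2
        rw [e0, e1, e2, e]
      exact ((ContinuousAt.eventuallyEq_nhds_iff_eventuallyEq_nhdsNE (by fun_prop)
        (by fun_prop)).1 this).eq_of_nhds
    refine hnonconst ⟨V 0, fun z hz => ?_⟩
    have : V z = v z := ((ContinuousAt.eventuallyEq_nhds_iff_eventuallyEq_nhdsNE
      (hV z).continuousAt hz.continuousAt).1 (hVv z)).eq_of_nhds
    rw [← this]
    exact entire_solution_const (fun z => (hV z).differentiableAt) hVode z 0

/-- If `w'' + c·w' − (6/λ)(w − e₁)(w − e₂) = 0` (with `λ ≠ 0`) admits a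
nonconstant meromorphic solution on `ℂ`, then
`c·(c²λ + 25(e₁ − e₂))·(c²λ − 25(e₁ − e₂)) = 0`. -/
theorem fisher_deg2_necessary_condition (lam : ℂ) (hlam : lam ≠ 0) (c e₁ e₂ : ℂ)
    (w : ℂ → ℂ) (hmero : MeromorphicOn w Set.univ)
    (heq : ∀ z : ℂ, AnalyticAt ℂ w z →
      deriv (deriv w) z + c * deriv w z
        - (6 / lam) * (w z - e₁) * (w z - e₂) = 0)
    (hnonconst : ¬ ∃ C : ℂ, ∀ z : ℂ, AnalyticAt ℂ w z → w z = C) :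
    c * (c ^ 2 * lam + 25 * (e₁ - e₂)) * (c ^ 2 * lam - 25 * (e₁ - e₂)) = 0 := by
  let v : ℂ → ℂ := fun z => w z / lam
  have hwv : w = fun z => lam * v z := by
    funext z
    simp only [v]
    field_simp
  have hvw : ∀ z, AnalyticAt ℂ v z → AnalyticAt ℂ w z := fun z hz => by
    rw [hwv]
    fun_prop
  have hd : deriv v = fun z => deriv w z / lam := by
    funext z
    exact deriv_div_const _
  have key := condition_of_normalized (c := c) (f₁ := e₁ / lam) (f₂ := e₂ / lam) (v := v)
    (fun z hz => by
      have := hmero z hz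
      simp only [v]
      fun_prop)
    (fun z hz => by
      have := heq z (hvw z hz)
      rw [hd, deriv_div_const]
      simp only [v]
      field_simp
      field_simp at this
      linear_combination this)
    (by
      rintro ⟨C, hC⟩
      refine hnonconst ⟨lam * C, fun z hz => ?_⟩
      rw [← hC z (by simp only [v]; fun_prop (disch := exact hlam)), hwv])
  field_simp at key
  linear_combination key
end

section
/- Let λ ∈ ℂ \ {0}, c, q_1, q_2, q_3 ∈ ℂ. If the differential equation w'' + c·w' − (2/λ²)(w − q_1)(w − q_2)(w − q_3) = 0 admits a nonconstant meromorphic solution on ℂ, then c · ∏_{(i,j,k)} (cλ + q_i + q_j − 2 q_k)(−cλ + q_i + q_j − 2 q_k) = 0, where the product runs over the three choices ((i,j,k)) = ((1,2,3), (1,3,2), (2,3,1)) of two indices i, j and the remaining index k. -/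
open Filter Topology

/-- An entire solution of `f'' + c f' = k (f - q₁)(f - q₂)(f - q₃)` with `k ≠ 0` is bounded. -/
theorem exists_bound_of_entire_solution {f : ℂ → ℂ} (hf : Differentiable ℂ f)
    {k c q₁ q₂ q₃ : ℂ} (hk : k ≠ 0)
    (heq : ∀ z, deriv (deriv f) z + c * deriv f z - k * (f z - q₁) * (f z - q₂) * (f z - q₃) = 0) :
    ∃ K, ∀ z, ‖f z‖ ≤ K := by
  by_contra! hunb
  set Q : ℝ := 2 * (‖q₁‖ + ‖q₂‖ + ‖q₃‖) + 1 with hQ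
  have hQ1 : 1 ≤ Q := by have := norm_nonneg q₁; have := norm_nonneg q₂; have := norm_nonneg q₃; linarith
  have hk0 : 0 < ‖k‖ := norm_pos_iff.2 hk
  set N : ℝ := (128 + 32 * ‖c‖) / ‖k‖ + 1 with hN
  have hN1 : 1 ≤ N := by
    have : 0 ≤ (128 + 32 * ‖c‖) / ‖k‖ := by positivity
    linarith
  obtain ⟨z₁, hz₁⟩ := hunb (2 * Q)
  set R : ℝ := 2 * ‖z₁‖ + 2 * N with hR
  have hz₁0 := norm_nonneg z₁
  -- A rescaling point: maximise `‖f z‖ (R - ‖z‖)` over the disc of radius `R`.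
  obtain ⟨z, hzR, hmax⟩ := (isCompact_closedBall (0 : ℂ) R).exists_isMaxOn
    ⟨z₁, by rw [mem_closedBall_zero_iff]; linarith⟩
    (f := fun z ↦ ‖f z‖ * (R - ‖z‖)) (by have := hf.continuous; fun_prop)
  rw [mem_closedBall_zero_iff] at hzR
  have hmax' : ∀ y : ℂ, ‖y‖ ≤ R → ‖f y‖ * (R - ‖y‖) ≤ ‖f z‖ * (R - ‖z‖) := fun y hy ↦
    hmax (mem_closedBall_zero_iff.2 hy)
  set d := R - ‖z‖ with hd
  set m := ‖f z‖ with hm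
  have hm0 : 0 ≤ m := norm_nonneg _
  have h1 : Q * R ≤ m * d := by
    have h := hmax' z₁ (by linarith)
    nlinarith
  have hmd : N ≤ m * d := by nlinarith
  have hd0 : 0 < d := by
    by_contra! h
    nlinarith
  have hmQ : Q ≤ m := by
    have : d ≤ R := by have := norm_nonneg z; linarith
    by_contra! h
    nlinarith
  have hbd : ∀ y ∈ Metric.sphere z (d / 2), ‖f y‖ ≤ 2 * m := by
    intro y hy
    rw [mem_sphere_iff_norm] at hy
    have : ‖y‖ ≤ ‖z‖ + d / 2 := by
      have := norm_add_le z (y - z)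
      rw [add_sub_cancel] at this
      linarith
    have h := hmax' y (by linarith)
    have := norm_nonneg (f y)
    by_contra! h'
    nlinarith
  have e1 := Complex.norm_iteratedDeriv_le_of_forall_mem_sphere_norm_le 1 (half_pos hd0)
    hf.diffContOnCl hbd
  have e2 := Complex.norm_iteratedDeriv_le_of_forall_mem_sphere_norm_le 2 (half_pos hd0)
    hf.diffContOnCl hbd
  rw [iteratedDeriv_one] at e1
  rw [iteratedDeriv_succ, iteratedDeriv_one] at e2
  have e1' : ‖deriv f z‖ * d ≤ 4 * m := by
    rw [le_div_iff₀ (by positivity)] at e1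
    norm_num at e1; linarith
  have e2' : ‖deriv (deriv f) z‖ * d ^ 2 ≤ 16 * m := by
    rw [le_div_iff₀ (by positivity)] at e2
    norm_num [Nat.factorial] at e2; nlinarith
  have hq : ∀ q : ℂ, 2 * ‖q‖ ≤ Q → m / 2 ≤ ‖f z - q‖ := fun q hq ↦ by
    have := norm_sub_norm_le (f z) q
    linarith
  have n1 := norm_nonneg q₁
  have n2 := norm_nonneg q₂
  have n3 := norm_nonneg q₃
  have hlow : ‖k‖ * (m / 2) * (m / 2) * (m / 2) ≤ ‖deriv (deriv f) z‖ + ‖c‖ * ‖deriv f z‖ := by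
    calc ‖k‖ * (m / 2) * (m / 2) * (m / 2)
        ≤ ‖k‖ * ‖f z - q₁‖ * ‖f z - q₂‖ * ‖f z - q₃‖ := by
          gcongr <;> apply hq <;> linarith
      _ = ‖k * (f z - q₁) * (f z - q₂) * (f z - q₃)‖ := by simp
      _ = ‖deriv (deriv f) z + c * deriv f z‖ := by rw [sub_eq_zero.1 (heq z)]
      _ ≤ _ := (norm_add_le _ _).trans (by rw [norm_mul])
  have hmpos : 0 < m := by linarith
  have hc := norm_nonneg c
  have h3 : ‖k‖ * (m / 2) * (m / 2) * (m / 2) * d ^ 2 ≤ 16 * m + ‖c‖ * (4 * m) * d := by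
    calc _ ≤ (‖deriv (deriv f) z‖ + ‖c‖ * ‖deriv f z‖) * d ^ 2 := by gcongr
      _ = ‖deriv (deriv f) z‖ * d ^ 2 + ‖c‖ * (‖deriv f z‖ * d) * d := by ring
      _ ≤ _ := by gcongr
  have h4 : ‖k‖ * (m * d) ^ 2 ≤ 128 + 32 * ‖c‖ * d := by
    refine le_of_mul_le_mul_left ?_ hmpos
    linear_combination 8 * h3
  have h5 : ‖k‖ * (m * d) ≤ 128 + 32 * ‖c‖ := by
    have hp : 0 < m * d := by positivity
    have h6 : d ≤ m * d := by nlinarith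
    refine le_of_mul_le_mul_right ?_ hp
    have h7 := mul_le_mul_of_nonneg_left h6 hc
    linear_combination h4 + 32 * h7 + 128 * (hN1.trans hmd)
  have h6 : ‖k‖ * N = 128 + 32 * ‖c‖ + ‖k‖ := by rw [hN]; field_simp
  have := mul_le_mul_of_nonneg_left hmd hk0.le
  linarith

/-- If an analytic `u` with `u z₀ = 0` satisfies the equation for the reciprocal of a solution,
then the resonance condition at `z₀` holds, with `a = u' z₀`. -/
theorem resonance_condition {u : ℂ → ℂ} {z₀ : ℂ} (hu : AnalyticAt ℂ u z₀) (hu0 : u z₀ = 0)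
    {k c q₁ q₂ q₃ : ℂ} (hk : k ≠ 0)
    (heq : ∀ᶠ z in 𝓝 z₀, -u z * deriv (deriv u) z + 2 * deriv u z ^ 2 - c * u z * deriv u z
      - k * (1 - q₁ * u z) * (1 - q₂ * u z) * (1 - q₃ * u z) = 0) :
    ∃ a, 2 * a ^ 2 = k ∧
      c * (c + a * (q₁ + q₂ - 2 * q₃)) * (c + a * (q₁ + q₃ - 2 * q₂))
        * (c + a * (q₂ + q₃ - 2 * q₁)) = 0 := by
  set d : ℕ → ℂ → ℂ := fun n ↦ deriv^[n] u with hd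
  have hda : ∀ n, AnalyticAt ℂ (d n) z₀ := fun n ↦ hu.iterated_deriv n
  have hder : ∀ n, ∀ᶠ z in 𝓝 z₀, HasDerivAt (d n) (d (n + 1) z) z := fun n ↦ by
    filter_upwards [(hda n).eventually_analyticAt] with z hz
    have := hz.differentiableAt.hasDerivAt
    rwa [← Function.iterate_succ_apply' deriv n u] at this
  have hdiff : ∀ {F G : ℂ → ℂ}, (∀ᶠ z in 𝓝 z₀, F z = 0) →
      (∀ᶠ z in 𝓝 z₀, HasDerivAt F (G z) z) → ∀ᶠ z in 𝓝 z₀, G z = 0 := by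
    intro F G hF hG
    filter_upwards [eventually_eventually_nhds.2 hF, hG] with z h1 h2
    have h3 : F =ᶠ[𝓝 z] fun _ ↦ 0 := h1
    rw [← h2.deriv, h3.deriv_eq, deriv_const]
  set A := q₁ + q₂ + q₃ with hA
  set B := q₁ * q₂ + q₁ * q₃ + q₂ * q₃ with hB
  set C := q₁ * q₂ * q₃ with hC
  have E0 : ∀ᶠ z in 𝓝 z₀, -d 0 z * d 2 z + 2 * d 1 z ^ 2 - c * d 0 z * d 1 z
      - k * (1 - A * d 0 z + B * d 0 z ^ 2 - C * d 0 z ^ 3) = 0 := by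
    filter_upwards [heq] with z hz
    rw [← hz]
    simp only [hd, Function.iterate_succ_apply', Function.iterate_zero, id]
    rw [hA, hB, hC]; ring
  have E1 : ∀ᶠ z in 𝓝 z₀, -d 0 z * d 3 z + 3 * d 1 z * d 2 z - c * (d 1 z ^ 2 + d 0 z * d 2 z)
      + k * A * d 1 z - 2 * k * B * d 0 z * d 1 z + 3 * k * C * d 0 z ^ 2 * d 1 z = 0 := by
    refine hdiff E0 ?_
    filter_upwards [hder 0, hder 1, hder 2] with z h0 h1 h2
    refine HasDerivAt.congr_deriv
      ((((h0.fun_neg.fun_mul h2).fun_add ((h1.fun_pow 2).const_mul 2)).fun_sub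
      ((h0.const_mul c).fun_mul h1)).fun_sub
      (((((h0.const_mul A).const_sub 1).fun_add ((h0.fun_pow 2).const_mul B)).fun_sub
        ((h0.fun_pow 3).const_mul C)).const_mul k)) ?_
    push_cast; ring
  have E2 : ∀ᶠ z in 𝓝 z₀, -d 0 z * d 4 z + 2 * d 1 z * d 3 z + 3 * d 2 z ^ 2
      - c * (3 * d 1 z * d 2 z + d 0 z * d 3 z) + k * A * d 2 z
      - 2 * k * B * (d 1 z ^ 2 + d 0 z * d 2 z)
      + 3 * k * C * (2 * d 0 z * d 1 z ^ 2 + d 0 z ^ 2 * d 2 z) = 0 := by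
    refine hdiff E1 ?_
    filter_upwards [hder 0, hder 1, hder 2, hder 3] with z h0 h1 h2 h3
    refine HasDerivAt.congr_deriv
      ((((((h0.fun_neg.fun_mul h3).fun_add ((h1.const_mul 3).fun_mul h2)).fun_sub
      (((h1.fun_pow 2).fun_add (h0.fun_mul h2)).const_mul c)).fun_add
      (h1.const_mul (k * A))).fun_sub ((h0.const_mul (2 * k * B)).fun_mul h1)).fun_add
      (((h0.fun_pow 2).const_mul (3 * k * C)).fun_mul h1)) ?_
    push_cast; ring
  have E3 : ∀ᶠ z in 𝓝 z₀, -d 0 z * d 5 z + d 1 z * d 4 z + 8 * d 2 z * d 3 z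
      - c * (3 * d 2 z ^ 2 + 4 * d 1 z * d 3 z + d 0 z * d 4 z) + k * A * d 3 z
      - 2 * k * B * (3 * d 1 z * d 2 z + d 0 z * d 3 z)
      + 3 * k * C * (2 * d 1 z ^ 3 + 6 * d 0 z * d 1 z * d 2 z + d 0 z ^ 2 * d 3 z) = 0 := by
    refine hdiff E2 ?_
    filter_upwards [hder 0, hder 1, hder 2, hder 3, hder 4] with z h0 h1 h2 h3 h4
    refine HasDerivAt.congr_deriv
      (((((((h0.fun_neg.fun_mul h4).fun_add ((h1.const_mul 2).fun_mul h3)).fun_add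
      ((h2.fun_pow 2).const_mul 3)).fun_sub
      ((((h1.const_mul 3).fun_mul h2).fun_add (h0.fun_mul h3)).const_mul c)).fun_add
      (h2.const_mul (k * A))).fun_sub
      (((h1.fun_pow 2).fun_add (h0.fun_mul h2)).const_mul (2 * k * B))).fun_add
      ((((h0.const_mul 2).fun_mul (h1.fun_pow 2)).fun_add
        ((h0.fun_pow 2).fun_mul h2)).const_mul (3 * k * C))) ?_
    push_cast; ring
  have E4 : ∀ᶠ z in 𝓝 z₀, -d 0 z * d 6 z + 9 * d 2 z * d 4 z + 8 * d 3 z ^ 2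
      - c * (10 * d 2 z * d 3 z + 5 * d 1 z * d 4 z + d 0 z * d 5 z) + k * A * d 4 z
      - 2 * k * B * (3 * d 2 z ^ 2 + 4 * d 1 z * d 3 z + d 0 z * d 4 z)
      + 3 * k * C * (12 * d 1 z ^ 2 * d 2 z + 6 * d 0 z * d 2 z ^ 2 + 8 * d 0 z * d 1 z * d 3 z
        + d 0 z ^ 2 * d 4 z) = 0 := by
    refine hdiff E3 ?_
    filter_upwards [hder 0, hder 1, hder 2, hder 3, hder 4, hder 5] with z h0 h1 h2 h3 h4 h5
    refine HasDerivAt.congr_deriv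
      (((((((h0.fun_neg.fun_mul h5).fun_add (h1.fun_mul h4)).fun_add
      ((h2.const_mul 8).fun_mul h3)).fun_sub
      (((((h2.fun_pow 2).const_mul 3).fun_add ((h1.const_mul 4).fun_mul h3)).fun_add
        (h0.fun_mul h4)).const_mul c)).fun_add
      (h3.const_mul (k * A))).fun_sub
      ((((h1.const_mul 3).fun_mul h2).fun_add (h0.fun_mul h3)).const_mul (2 * k * B))).fun_add
      (((((h1.fun_pow 3).const_mul 2).fun_add (((h0.const_mul 6).fun_mul h1).fun_mul h2)).fun_add
        ((h0.fun_pow 2).fun_mul h3)).const_mul (3 * k * C))) ?_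
    push_cast; ring
  have d0 : d 0 z₀ = 0 := hu0
  replace E0 := E0.self_of_nhds
  replace E1 := E1.self_of_nhds
  replace E2 := E2.self_of_nhds
  replace E3 := E3.self_of_nhds
  replace E4 := E4.self_of_nhds
  generalize d 1 z₀ = a, d 2 z₀ = u₂, d 3 z₀ = u₃, d 4 z₀ = u₄, d 5 z₀ = u₅, d 6 z₀ = u₆
    at E0 E1 E2 E3 E4
  rw [d0] at E0 E1 E2 E3 E4
  have hak : k = 2 * a ^ 2 := by linear_combination -E0
  subst hak
  have ha : a ≠ 0 := by rintro rfl; simp at hk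
  obtain ⟨x, rfl⟩ : ∃ x, u₂ = a * x := ⟨u₂ / a, by field_simp⟩
  obtain ⟨y, rfl⟩ : ∃ y, u₃ = a * y := ⟨u₃ / a, by field_simp⟩
  obtain ⟨t, rfl⟩ : ∃ t, u₄ = a * t := ⟨u₄ / a, by field_simp⟩
  have hx : x = (c - 2 * a * A) / 3 := by
    refine mul_left_cancel₀ (pow_ne_zero 2 ha) ?_
    linear_combination E1 / 3
  have hy : y = (-3 * x ^ 2 + 3 * c * x - 2 * a * A * x + 4 * a ^ 2 * B) / 2 := by
    refine mul_left_cancel₀ (pow_ne_zero 2 ha) ?_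
    linear_combination E2 / 2
  have ht : t = -8 * x * y + c * (3 * x ^ 2 + 4 * y) - 2 * a * A * y + 12 * a ^ 2 * B * x
      - 12 * a ^ 3 * C := by
    refine mul_left_cancel₀ (pow_ne_zero 2 ha) ?_
    linear_combination E3
  have hfin : 9 * x * t + 8 * y ^ 2 - c * (10 * x * y + 5 * t) + 2 * a * A * t
      - 4 * a ^ 2 * B * (3 * x ^ 2 + 4 * y) + 72 * a ^ 3 * C * x = 0 := by
    refine mul_left_cancel₀ (pow_ne_zero 2 ha) ?_
    linear_combination E4
  refine ⟨a, rfl, ?_⟩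
  rw [ht, hy, hx, hA, hB, hC] at hfin
  linear_combination (-9 / 16) * hfin

/-- If a function with a pole at `z₀` solves the equation near `z₀`, then its reciprocal extends
analytically to `z₀` by `0` and solves the transformed equation. -/
theorem exists_analytic_reciprocal {w : ℂ → ℂ} {z₀ : ℂ} (hw : MeromorphicAt w z₀)
    (hpole : meromorphicOrderAt w z₀ < 0) {k c q₁ q₂ q₃ : ℂ}
    (heq : ∀ z, AnalyticAt ℂ w z →
      deriv (deriv w) z + c * deriv w z - k * (w z - q₁) * (w z - q₂) * (w z - q₃) = 0) :
    ∃ u : ℂ → ℂ, AnalyticAt ℂ u z₀ ∧ u z₀ = 0 ∧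
      ∀ᶠ z in 𝓝 z₀, -u z * deriv (deriv u) z + 2 * deriv u z ^ 2 - c * u z * deriv u z
        - k * (1 - q₁ * u z) * (1 - q₂ * u z) * (1 - q₃ * u z) = 0 := by
  have hord : 0 < meromorphicOrderAt w⁻¹ z₀ := by
    rw [meromorphicOrderAt_inv]
    revert hpole
    cases meromorphicOrderAt w z₀ with
    | top => simp
    | coe n => intro h; norm_cast at h ⊢; simpa using! h
  set u := toMeromorphicNFAt w⁻¹ z₀ with hu
  have hua : AnalyticAt ℂ u z₀ :=
    hw.inv.meromorphicOrderAt_nonneg_iff_analyticAt_toMeromorphicNFAt.1 hord.le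
  have huw : ∀ z, z ≠ z₀ → w z = (u z)⁻¹ := fun z hz ↦ by
    rw [hu, ← hw.inv.eqOn_compl_singleton_toMeromorphicNFAt hz, Pi.inv_apply, inv_inv]
  refine ⟨u, hua, toMeromorphicNFAt_of_meromorphicOrderAt_ne_zero hord.ne', ?_⟩
  have hF : AnalyticAt ℂ (fun z ↦ -u z * deriv (deriv u) z + 2 * deriv u z ^ 2
      - c * u z * deriv u z - k * (1 - q₁ * u z) * (1 - q₂ * u z) * (1 - q₃ * u z)) z₀ := by
    have := hua.deriv
    have := hua.deriv.deriv
    fun_prop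
  refine hF.frequently_zero_iff_eventually_zero.1 (Eventually.frequently ?_)
  have hne : ∀ᶠ z in 𝓝[≠] z₀, w z ≠ 0 :=
    (tendsto_cobounded_of_meromorphicOrderAt_neg hpole).eventually_ne_cobounded 0
  filter_upwards [hw.eventually_analyticAt, hne, self_mem_nhdsWithin,
    hua.eventually_analyticAt.filter_mono nhdsWithin_le_nhds] with z hwz hwne hz huz
  have hune : u z ≠ 0 := fun h ↦ hwne (by rw [huw z hz, h, inv_zero])
  have hwu : w =ᶠ[𝓝 z] fun y ↦ (u y)⁻¹ := by
    filter_upwards [isOpen_ne.mem_nhds hz] with y hy using huw y hy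
  have hd1 : ∀ᶠ y in 𝓝 z, deriv w y = -deriv u y / u y ^ 2 := by
    filter_upwards [hwu.eventuallyEq_nhds, huz.eventually_analyticAt,
      huz.continuousAt.eventually_ne hune] with y h1 h2 h3
    rw [h1.deriv_eq]
    exact (h2.differentiableAt.hasDerivAt.fun_inv h3).deriv
  have hd2 : deriv (deriv w) z =
      (-deriv (deriv u) z * u z ^ 2 + deriv u z * (2 * u z * deriv u z)) / (u z ^ 2) ^ 2 := by
    rw [EventuallyEq.deriv_eq hd1]
    have h := (huz.deriv.differentiableAt.hasDerivAt.fun_neg.fun_div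
      (huz.differentiableAt.hasDerivAt.fun_pow 2) (pow_ne_zero 2 hune)).deriv
    rw [h]
    push_cast; ring
  have h := heq z hwz
  rw [hd2, hd1.self_of_nhds, huw z hz] at h
  field_simp at h
  linear_combination h

/-- A solution without poles agrees with a constant wherever it is analytic. -/
theorem eq_const_of_forall_order_nonneg {w : ℂ → ℂ} (hmero : MeromorphicOn w Set.univ)
    (hord : ∀ z, 0 ≤ meromorphicOrderAt w z) {k c q₁ q₂ q₃ : ℂ} (hk : k ≠ 0)
    (heq : ∀ z, AnalyticAt ℂ w z →
      deriv (deriv w) z + c * deriv w z - k * (w z - q₁) * (w z - q₂) * (w z - q₃) = 0) :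
    ∃ C, ∀ z, AnalyticAt ℂ w z → w z = C := by
  set f := toMeromorphicNFOn w Set.univ with hf
  have hfa : ∀ z, AnalyticAt ℂ f z := fun z ↦ by
    rw [← (meromorphicNFOn_toMeromorphicNFOn w Set.univ
      (Set.mem_univ z)).meromorphicOrderAt_nonneg_iff_analyticAt,
      meromorphicOrderAt_toMeromorphicNFOn hmero (Set.mem_univ z)]
    exact hord z
  have hfw : ∀ z, AnalyticAt ℂ w z → f =ᶠ[𝓝 z] w := fun z hz ↦
    ((hfa z).continuousAt.eventuallyEq_nhds_iff_eventuallyEq_nhdsNE hz.continuousAt).1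
      (hmero.toMeromorphicNFOn_eq_self_on_nhdsNE (Set.mem_univ z))
  have hfd : Differentiable ℂ f := fun z ↦ (hfa z).differentiableAt
  have hfeq : ∀ z, deriv (deriv f) z + c * deriv f z
      - k * (f z - q₁) * (f z - q₂) * (f z - q₃) = 0 := fun z ↦ by
    have hF : AnalyticAt ℂ (fun z ↦ deriv (deriv f) z + c * deriv f z
        - k * (f z - q₁) * (f z - q₂) * (f z - q₃)) z := by
      have := hfa z
      have := (hfa z).deriv
      have := (hfa z).deriv.deriv
      fun_prop
    refine (hF.frequently_zero_iff_eventually_zero.1 (Eventually.frequently ?_)).self_of_nhds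
    filter_upwards [(hmero z (Set.mem_univ z)).eventually_analyticAt] with y hy
    have h := hfw y hy
    rw [h.deriv.deriv_eq, h.deriv_eq, h.eq_of_nhds]
    exact heq y hy
  obtain ⟨K, hK⟩ := exists_bound_of_entire_solution hfd hk hfeq
  refine ⟨f 0, fun z hz ↦ ?_⟩
  rw [← (hfw z hz).eq_of_nhds]
  refine hfd.apply_eq_apply_of_bounded (isBounded_iff_forall_norm_le.2 ⟨K, ?_⟩) z 0
  rintro _ ⟨y, rfl⟩
  exact hK y


/-- If `w'' + c·w' − (2/λ²)(w − q₁)(w − q₂)(w − q₃) = 0` (with `λ ≠ 0`)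
admits a nonconstant meromorphic solution on `ℂ`, then
`c · ∏ (cλ + qᵢ + qⱼ − 2 qₖ)(−cλ + qᵢ + qⱼ − 2 qₖ) = 0`, the product running over the three
choices `(i,j,k) = (1,2,3), (1,3,2), (2,3,1)`. -/
theorem fisher_deg3_necessary_condition (lam : ℂ) (hlam : lam ≠ 0) (c q₁ q₂ q₃ : ℂ)
    (w : ℂ → ℂ) (hmero : MeromorphicOn w Set.univ)
    (heq : ∀ z : ℂ, AnalyticAt ℂ w z →
      deriv (deriv w) z + c * deriv w z
        - (2 / lam ^ 2) * (w z - q₁) * (w z - q₂) * (w z - q₃) = 0)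
    (hnonconst : ¬ ∃ C : ℂ, ∀ z : ℂ, AnalyticAt ℂ w z → w z = C) :
    c * ((c * lam + q₁ + q₂ - 2 * q₃) * (-(c * lam) + q₁ + q₂ - 2 * q₃))
      * ((c * lam + q₁ + q₃ - 2 * q₂) * (-(c * lam) + q₁ + q₃ - 2 * q₂))
      * ((c * lam + q₂ + q₃ - 2 * q₁) * (-(c * lam) + q₂ + q₃ - 2 * q₁)) = 0 := by
  have hk : 2 / lam ^ 2 ≠ 0 := div_ne_zero two_ne_zero (pow_ne_zero 2 hlam)
  have hpole : ∃ z, meromorphicOrderAt w z < 0 := by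
    by_contra! h
    exact hnonconst (eq_const_of_forall_order_nonneg hmero h hk heq)
  obtain ⟨z₀, hz₀⟩ := hpole
  obtain ⟨u, hua, hu0, hueq⟩ := exists_analytic_reciprocal (hmero z₀ (Set.mem_univ z₀)) hz₀ heq
  obtain ⟨a, ha, hres⟩ := resonance_condition hua hu0 hk hueq
  have hla : (lam * a - 1) * (lam * a + 1) = 0 := by
    field_simp at ha
    linear_combination ha
  have hzero : c * (c * lam + (lam * a) * (q₁ + q₂ - 2 * q₃))
      * (c * lam + (lam * a) * (q₁ + q₃ - 2 * q₂))
      * (c * lam + (lam * a) * (q₂ + q₃ - 2 * q₁)) = 0 := by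
    linear_combination lam ^ 3 * hres
  rcases mul_eq_zero.1 hla with h | h
  · rw [sub_eq_zero.1 h] at hzero
    linear_combination (-(c * lam) + q₁ + q₂ - 2 * q₃) * (-(c * lam) + q₁ + q₃ - 2 * q₂)
      * (-(c * lam) + q₂ + q₃ - 2 * q₁) * hzero
  · rw [eq_neg_of_add_eq_zero_left h] at hzero
    linear_combination -(c * lam + q₁ + q₂ - 2 * q₃) * (c * lam + q₁ + q₃ - 2 * q₂)
      * (c * lam + q₂ + q₃ - 2 * q₁) * hzero
end

section
/- Let λ ∈ ℂ \ {0}, let (i, j, k) be a permutation of (1, 2, 3), let q_1, q_2, q_3 ∈ ℂ with q_j ≠ q_k, let z_0 ∈ ℂ, and set c = (2 q_i − q_j − q_k)/λ. Then the function w(z) = (q_j · e^{q_j (z − z_0)/λ} − q_k · e^{q_k (z − z_0)/λ}) / (e^{q_j (z − z_0)/λ} − e^{q_k (z − z_0)/λ}) satisfies w''(z) + c·w'(z) − (2/λ²)(w(z) − q_1)(w(z) − q_2)(w(z) − q_3) = 0 at every z ∈ ℂ where the denominator e^{q_j (z − z_0)/λ} − e^{q_k (z − z_0)/λ} is nonzero.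 -/
/-- A quotient `(a eᵃˣ - b eᵇˣ) / (eᵃˣ - eᵇˣ)`, with `x = (z - z₀) / l`, satisfies a Riccati
equation whose stationary points are `a` and `b`. -/
theorem hasDerivAt_exp_quotient_riccati {l a b z₀ z : ℂ} {w : ℂ → ℂ}
    (hw : ∀ z : ℂ, w z =
      (a * Complex.exp (a * (z - z₀) / l) - b * Complex.exp (b * (z - z₀) / l)) /
        (Complex.exp (a * (z - z₀) / l) - Complex.exp (b * (z - z₀) / l)))
    (hz : Complex.exp (a * (z - z₀) / l) - Complex.exp (b * (z - z₀) / l) ≠ 0) :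
    HasDerivAt w (-((w z - a) * (w z - b)) / l) z := by
  have hexp (q : ℂ) : HasDerivAt (fun z => Complex.exp (q * (z - z₀) / l))
      (Complex.exp (q * (z - z₀) / l) * (q * 1 / l)) z :=
    ((((hasDerivAt_id z).sub_const z₀).const_mul q).div_const l).cexp
  have hquot := (((hexp a).const_mul a).sub ((hexp b).const_mul b)).div ((hexp a).sub (hexp b)) hz
  rw [funext hw]
  refine hquot.congr_deriv ?_
  simp only [Pi.sub_apply]
  generalize Complex.exp (a * (z - z₀) / l) = A at *
  generalize Complex.exp (b * (z - z₀) / l) = B at *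
  field_simp
  ring


/-- Let `λ ≠ 0`, let `(i,j,k)` be a permutation of `(1,2,3)` with
corresponding roots `qᵢ, qⱼ, qₖ` (here named `qi, qj, qk`, `qj ≠ qk`), let
`c = (2 qᵢ − qⱼ − qₖ)/λ`.  Then
`w(z) = (qⱼ e^{qⱼ(z − z₀)/λ} − qₖ e^{qₖ(z − z₀)/λ}) / (e^{qⱼ(z − z₀)/λ} − e^{qₖ(z − z₀)/λ})`
solves `w'' + c·w' − (2/λ²)(w − qᵢ)(w − qⱼ)(w − qₖ) = 0` wherever the denominator is
nonzero. -/
theorem fisher_deg3_explicit_solution (lam : ℂ) (hlam : lam ≠ 0) (qi qj qk : ℂ)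
    (hjk : qj ≠ qk) (z₀ : ℂ) (c : ℂ) (hc : c = (2 * qi - qj - qk) / lam)
    (w : ℂ → ℂ)
    (hw : ∀ z : ℂ, w z =
      (qj * Complex.exp (qj * (z - z₀) / lam) - qk * Complex.exp (qk * (z - z₀) / lam)) /
        (Complex.exp (qj * (z - z₀) / lam) - Complex.exp (qk * (z - z₀) / lam))) :
    ∀ z : ℂ,
      Complex.exp (qj * (z - z₀) / lam) - Complex.exp (qk * (z - z₀) / lam) ≠ 0 →
      deriv (deriv w) z + c * deriv w z
        - (2 / lam ^ 2) * (w z - qi) * (w z - qj) * (w z - qk) = 0 := by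
  intro z hz
  have hne : ∀ᶠ y in nhds z,
      Complex.exp (qj * (y - z₀) / lam) - Complex.exp (qk * (y - z₀) / lam) ≠ 0 :=
    ContinuousAt.eventually_ne (by fun_prop) hz
  have hderiv : deriv w =ᶠ[nhds z] fun y => -((w y - qj) * (w y - qk)) / lam :=
    hne.mono fun y hy => (hasDerivAt_exp_quotient_riccati hw hy).deriv
  have hwz := hasDerivAt_exp_quotient_riccati hw hz
  have hsecond := ((hwz.sub_const qj).fun_mul (hwz.sub_const qk)).fun_neg.div_const lam
  rw [hderiv.deriv_eq, hsecond.deriv, hwz.deriv, hc]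
  field_simp
  ring
end
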